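/- arXiv:1705.09514 — 6 statements merged into one kernel-verified Lean document; each statement's English description precedes it below -/
import Mathlib

section
/- For each fixed ξ ∈ ℝⁿ, the function ζ₀(t,ξ) = A(t,ξ) cos(B(t,ξ)) satisfies the ordinary differential equation ∂ₜ²ζ₀(t,ξ) + L(t,ξ) ζ₀(t,ξ) = 0 with initial conditions ζ₀(0,ξ) = 1 and ∂ₜζ₀(0,ξ) = 0, and moreover ∂ₜζ₀(t,ξ) = −A(t,ξ) Q(t,ξ) sin(B(t,ξ)) for all t. -/
/-- The derivative of `A cos B` for an amplitude `A` having logarithmic derivative `-r sin² B`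
and a phase `B` having derivative `Q - r sin B cos B`. -/
theorem hasDerivAt_amplitude_mul_cos {r Q B A : ℝ → ℝ} {t : ℝ}
    (hB : HasDerivAt B (Q t - r t * Real.sin (B t) * Real.cos (B t)) t)
    (hA : HasDerivAt A (-(A t * (r t * Real.sin (B t) ^ 2))) t) :
    HasDerivAt (fun τ => A τ * Real.cos (B τ)) (-(A t * Q t * Real.sin (B t))) t := by
  refine (hA.mul hB.cos).congr_deriv ?_
  ring

theorem hasDerivAt_neg_amplitude_mul_sin {Q B A : ℝ → ℝ} {t Q' : ℝ} (hQ0 : Q t ≠ 0)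
    (hQ : HasDerivAt Q Q' t)
    (hB : HasDerivAt B (Q t - Q' / Q t * Real.sin (B t) * Real.cos (B t)) t)
    (hA : HasDerivAt A (-(A t * (Q' / Q t * Real.sin (B t) ^ 2))) t) :
    HasDerivAt (fun τ => -(A τ * Q τ * Real.sin (B τ)))
      (-(Q t ^ 2 * (A t * Real.cos (B t)))) t := by
  refine ((hA.mul hQ).mul hB.sin).neg.congr_deriv ?_
  simp only [Pi.mul_apply]
  field_simp
  linear_combination (A t * Q' * Real.sin (B t)) * Real.sin_sq_add_cos_sq (B t)

theorem contDiff_one_integral {F : Type*} [NormedAddCommGroup F] [NormedSpace ℝ F]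
    [CompleteSpace F] {f : ℝ → F} (hf : Continuous f) :
    ContDiff ℝ 1 (fun t => ∫ s in (0:ℝ)..t, f s) := by
  have hd : ∀ t, HasDerivAt (fun t => ∫ s in (0:ℝ)..t, f s) (f t) t :=
    fun t => hf.integral_hasStrictDerivAt 0 t |>.hasDerivAt
  rw [contDiff_one_iff_deriv]
  exact ⟨fun t => (hd t).differentiableAt, by rwa [funext fun t => (hd t).deriv]⟩


open MeasureTheory in
theorem stmt_1
    (n : ℕ) (hn : 1 ≤ n) (c m q : ℝ) (hc : 0 < c) (hm : 0 < m) (hq : q ≠ 0)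
    (E : ℝ → EuclideanSpace ℝ (Fin n)) (E00 E01 : ℝ)
    (hE : ContDiff ℝ 1 E)
    (hE00 : ∀ t : ℝ, ∑ j, |E t j| ≤ E00)
    (hE01 : ∀ t : ℝ, ∑ j, |deriv E t j| ≤ E01)
    (b : ℝ → EuclideanSpace ℝ (Fin n))
    (hb : ∀ t : ℝ, b t = ∫ s in (0:ℝ)..t, q • E s)
    (L Q : ℝ → EuclideanSpace ℝ (Fin n) → ℝ)
    (hL : ∀ (t : ℝ) (ξ : EuclideanSpace ℝ (Fin n)),
      L t ξ = c ^ 2 * ‖ξ + b t‖ ^ 2 + (m * c ^ 2) ^ 2)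
    (hQ : ∀ (t : ℝ) (ξ : EuclideanSpace ℝ (Fin n)), Q t ξ = Real.sqrt (L t ξ))
    (B : ℝ → EuclideanSpace ℝ (Fin n) → ℝ)
    (hBC2 : ∀ ξ : EuclideanSpace ℝ (Fin n), ContDiff ℝ 2 (fun t => B t ξ))
    (hB : ∀ (t : ℝ) (ξ : EuclideanSpace ℝ (Fin n)), B t ξ =
      ∫ s in (0:ℝ)..t,
        (Q s ξ - deriv (fun τ => Q τ ξ) s / Q s ξ * Real.sin (B s ξ) * Real.cos (B s ξ)))
    (A : ℝ → EuclideanSpace ℝ (Fin n) → ℝ)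
    (hA : ∀ (t : ℝ) (ξ : EuclideanSpace ℝ (Fin n)), A t ξ =
      Real.exp (-∫ s in (0:ℝ)..t, deriv (fun τ => Q τ ξ) s / Q s ξ * Real.sin (B s ξ) ^ 2))
    :
    ∀ (ξ : EuclideanSpace ℝ (Fin n)) (t : ℝ),
      deriv (deriv (fun τ => A τ ξ * Real.cos (B τ ξ))) t
          + L t ξ * (A t ξ * Real.cos (B t ξ)) = 0 ∧
      A 0 ξ * Real.cos (B 0 ξ) = 1 ∧
      deriv (fun τ => A τ ξ * Real.cos (B τ ξ)) 0 = 0 ∧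
      deriv (fun τ => A τ ξ * Real.cos (B τ ξ)) t = -(A t ξ * Q t ξ * Real.sin (B t ξ)) := by
  intro ξ t
  have hLpos : ∀ t, 0 < L t ξ := fun t => by rw [hL]; positivity
  have hQpos : ∀ t, 0 < Q t ξ := fun t => by rw [hQ]; exact Real.sqrt_pos.2 (hLpos t)
  have hbC : ContDiff ℝ 1 b := by
    rw [funext hb]
    exact contDiff_one_integral (hE.continuous.const_smul q)
  have hLC : ContDiff ℝ 1 (fun t => L t ξ) := by
    simp only [hL]
    exact (contDiff_const.mul ((contDiff_const.add hbC).norm_sq ℝ)).add contDiff_const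
  have hQC : ContDiff ℝ 1 (fun t => Q t ξ) := by
    simp only [hQ]
    exact hLC.sqrt fun t => (hLpos t).ne'
  have hBc : Continuous (fun t => B t ξ) := (hBC2 ξ).continuous
  have hrc : Continuous (fun s => deriv (fun τ => Q τ ξ) s / Q s ξ) :=
    (hQC.continuous_deriv le_rfl).div hQC.continuous fun s => (hQpos s).ne'
  have hBd : ∀ t, HasDerivAt (fun τ => B τ ξ)
      (Q t ξ - deriv (fun τ => Q τ ξ) t / Q t ξ * Real.sin (B t ξ) * Real.cos (B t ξ)) t := by
    intro t
    have hcont : Continuous fun s =>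
        Q s ξ - deriv (fun τ => Q τ ξ) s / Q s ξ * Real.sin (B s ξ) * Real.cos (B s ξ) :=
      hQC.continuous.sub
        ((hrc.mul (Real.continuous_sin.comp hBc)).mul (Real.continuous_cos.comp hBc))
    exact (hcont.integral_hasStrictDerivAt 0 t).hasDerivAt.congr_of_eventuallyEq
      (Filter.Eventually.of_forall fun τ => hB τ ξ)
  have hAd : ∀ t, HasDerivAt (fun τ => A τ ξ)
      (-(A t ξ * (deriv (fun τ => Q τ ξ) t / Q t ξ * Real.sin (B t ξ) ^ 2))) t := by
    intro t
    have hcont : Continuous fun s =>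
        deriv (fun τ => Q τ ξ) s / Q s ξ * Real.sin (B s ξ) ^ 2 :=
      hrc.mul ((Real.continuous_sin.comp hBc).pow 2)
    rw [← mul_neg, hA t ξ]
    exact (hcont.integral_hasStrictDerivAt 0 t).hasDerivAt.neg.exp.congr_of_eventuallyEq
      (Filter.Eventually.of_forall fun τ => hA τ ξ)
  have hderiv : deriv (fun τ => A τ ξ * Real.cos (B τ ξ)) =
      fun t => -(A t ξ * Q t ξ * Real.sin (B t ξ)) :=
    funext fun t => (hasDerivAt_amplitude_mul_cos (Q := fun τ => Q τ ξ)
      (r := fun s => deriv (fun τ => Q τ ξ) s / Q s ξ) (hBd t) (hAd t)).deriv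
  have hQsq : Q t ξ ^ 2 = L t ξ := by rw [hQ, Real.sq_sqrt (hLpos t).le]
  have hB0 : B 0 ξ = 0 := by rw [hB, intervalIntegral.integral_same]
  have hA0 : A 0 ξ = 1 := by rw [hA, intervalIntegral.integral_same, neg_zero, Real.exp_zero]
  rw [hderiv]
  refine ⟨?_, by simp [hB0, hA0], by simp [hB0], rfl⟩
  rw [(hasDerivAt_neg_amplitude_mul_sin (Q := fun τ => Q τ ξ) (hQpos t).ne'
    (hQC.differentiable one_ne_zero t).hasDerivAt (hBd t) (hAd t)).deriv, hQsq, neg_add_cancel]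
end

section
/- For each fixed ξ ∈ ℝⁿ, the function ζ₁(t,ξ) = C(t,ξ) sin(D(t,ξ)) satisfies the ordinary differential equation ∂ₜ²ζ₁(t,ξ) + L(t,ξ) ζ₁(t,ξ) = 0 with initial conditions ζ₁(0,ξ) = 0 and ∂ₜζ₁(0,ξ) = 1, and moreover ∂ₜζ₁(t,ξ) = C(t,ξ) Q(t,ξ) cos(D(t,ξ)) for all t. -/
/-- The Prüfer transform: amplitude and phase of a solution of the oscillator equation with frequency `Q`. -/
theorem hasDerivAt_prufer {Q D C : ℝ → ℝ} (hQ : ContDiff ℝ 1 Q) (hpos : ∀ t, 0 < Q t)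
    (hDc : Continuous D)
    (hD : ∀ t, D t = ∫ s in (0:ℝ)..t, (Q s + deriv Q s / Q s * Real.sin (D s) * Real.cos (D s)))
    (hC : ∀ t, C t = (Q 0)⁻¹ * Real.exp (-∫ s in (0:ℝ)..t, deriv Q s / Q s * Real.cos (D s) ^ 2))
    (t : ℝ) :
    HasDerivAt (fun τ => C τ * Real.sin (D τ)) (C t * Q t * Real.cos (D t)) t ∧
      HasDerivAt (fun τ => C τ * Q τ * Real.cos (D τ)) (-(Q t ^ 2 * (C t * Real.sin (D t)))) t := by
  have hQderiv : Continuous (deriv Q) := hQ.continuous_deriv le_rfl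
  have hquot : Continuous fun s => deriv Q s / Q s :=
    hQderiv.div hQ.continuous fun s => (hpos s).ne'
  have hQd : HasDerivAt Q (deriv Q t) t := (hQ.differentiable one_ne_zero t).hasDerivAt
  have hDd : HasDerivAt D (Q t + deriv Q t / Q t * Real.sin (D t) * Real.cos (D t)) t := by
    have hcont : Continuous fun s => Q s + deriv Q s / Q s * Real.sin (D s) * Real.cos (D s) :=
      hQ.continuous.add
        ((hquot.mul (Real.continuous_sin.comp hDc)).mul (Real.continuous_cos.comp hDc))
    rw [funext hD]
    simpa only [← hD] using hcont.integral_hasStrictDerivAt 0 t |>.hasDerivAt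
  have hCd : HasDerivAt C (-(C t * (deriv Q t / Q t * Real.cos (D t) ^ 2))) t := by
    have hcont : Continuous fun s => deriv Q s / Q s * Real.cos (D s) ^ 2 :=
      hquot.mul ((Real.continuous_cos.comp hDc).pow 2)
    have h := ((hcont.integral_hasStrictDerivAt 0 t).hasDerivAt.neg.exp).const_mul (Q 0)⁻¹
    refine (h.congr_of_eventuallyEq (.of_forall hC)).congr_deriv ?_
    rw [hC t]
    simp only [Pi.neg_apply]
    ring
  have hne := (hpos t).ne'
  constructor
  · refine (hCd.mul hDd.sin).congr_deriv ?_
    field_simp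
    ring
  · refine ((hCd.mul hQd).mul hDd.cos).congr_deriv ?_
    simp only [Pi.mul_apply]
    field_simp
    linear_combination (-C t * deriv Q t * Real.cos (D t)) * Real.sin_sq_add_cos_sq (D t)

theorem contDiff_sqrt_mul_norm_sq_add {F : Type*} [NormedAddCommGroup F] [InnerProductSpace ℝ F]
    {f : ℝ → F} (hf : ContDiff ℝ 1 f) {a k : ℝ} (ha : 0 ≤ a) (hk : 0 < k) :
    ContDiff ℝ 1 fun t => Real.sqrt (a * ‖f t‖ ^ 2 + k) :=
  ((contDiff_const.mul (hf.norm_sq ℝ)).add contDiff_const).sqrt fun t => by positivity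


open MeasureTheory in
theorem stmt_2
    (n : ℕ) (hn : 1 ≤ n) (c m q : ℝ) (hc : 0 < c) (hm : 0 < m) (hq : q ≠ 0)
    (E : ℝ → EuclideanSpace ℝ (Fin n)) (E00 E01 : ℝ)
    (hE : ContDiff ℝ 1 E)
    (hE00 : ∀ t : ℝ, ∑ j, |E t j| ≤ E00)
    (hE01 : ∀ t : ℝ, ∑ j, |deriv E t j| ≤ E01)
    (b : ℝ → EuclideanSpace ℝ (Fin n))
    (hb : ∀ t : ℝ, b t = ∫ s in (0:ℝ)..t, q • E s)
    (L Q : ℝ → EuclideanSpace ℝ (Fin n) → ℝ)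
    (hL : ∀ (t : ℝ) (ξ : EuclideanSpace ℝ (Fin n)),
      L t ξ = c ^ 2 * ‖ξ + b t‖ ^ 2 + (m * c ^ 2) ^ 2)
    (hQ : ∀ (t : ℝ) (ξ : EuclideanSpace ℝ (Fin n)), Q t ξ = Real.sqrt (L t ξ))
    (D : ℝ → EuclideanSpace ℝ (Fin n) → ℝ)
    (hDC2 : ∀ ξ : EuclideanSpace ℝ (Fin n), ContDiff ℝ 2 (fun t => D t ξ))
    (hD : ∀ (t : ℝ) (ξ : EuclideanSpace ℝ (Fin n)), D t ξ =
      ∫ s in (0:ℝ)..t,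
        (Q s ξ + deriv (fun τ => Q τ ξ) s / Q s ξ * Real.sin (D s ξ) * Real.cos (D s ξ)))
    (Cc : ℝ → EuclideanSpace ℝ (Fin n) → ℝ)
    (hCc : ∀ (t : ℝ) (ξ : EuclideanSpace ℝ (Fin n)), Cc t ξ =
      (Q 0 ξ)⁻¹ * Real.exp (-∫ s in (0:ℝ)..t, deriv (fun τ => Q τ ξ) s / Q s ξ * Real.cos (D s ξ) ^ 2))
    :
    ∀ (ξ : EuclideanSpace ℝ (Fin n)) (t : ℝ),
      deriv (deriv (fun τ => Cc τ ξ * Real.sin (D τ ξ))) t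
          + L t ξ * (Cc t ξ * Real.sin (D t ξ)) = 0 ∧
      Cc 0 ξ * Real.sin (D 0 ξ) = 0 ∧
      deriv (fun τ => Cc τ ξ * Real.sin (D τ ξ)) 0 = 1 ∧
      deriv (fun τ => Cc τ ξ * Real.sin (D τ ξ)) t = Cc t ξ * Q t ξ * Real.cos (D t ξ) := by
  intro ξ t
  have hbd : ∀ t, HasDerivAt b (q • E t) t := fun t => by
    rw [funext hb]
    exact ((hE.continuous.const_smul q).integral_hasStrictDerivAt 0 t).hasDerivAt
  have hbC : ContDiff ℝ 1 b := by
    rw [contDiff_one_iff_deriv, funext fun t => (hbd t).deriv]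
    exact ⟨fun t => (hbd t).differentiableAt, hE.continuous.const_smul q⟩
  have hk : 0 < (m * c ^ 2) ^ 2 := by positivity
  have hLpos : ∀ t, 0 < L t ξ := fun t => by rw [hL]; positivity
  have hQpos : ∀ t, 0 < Q t ξ := fun t => by rw [hQ]; exact Real.sqrt_pos.2 (hLpos t)
  have hQC : ContDiff ℝ 1 fun t => Q t ξ := by
    simp only [hQ, hL]
    exact contDiff_sqrt_mul_norm_sq_add (contDiff_const.add hbC) (sq_nonneg c) hk
  have key := hasDerivAt_prufer hQC hQpos (hDC2 ξ).continuous (fun t => hD t ξ) (fun t => hCc t ξ)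
  have hD0 : D 0 ξ = 0 := by rw [hD, intervalIntegral.integral_same]
  have hC0 : Cc 0 ξ * Q 0 ξ = 1 := by
    rw [hCc, intervalIntegral.integral_same, neg_zero, Real.exp_zero, mul_one,
      inv_mul_cancel₀ (hQpos 0).ne']
  have hQsq : Q t ξ ^ 2 = L t ξ := by rw [hQ, Real.sq_sqrt (hLpos t).le]
  refine ⟨?_, by simp [hD0], ?_, (key t).1.deriv⟩
  · rw [funext fun τ => (key τ).1.deriv, (key t).2.deriv, hQsq, neg_add_cancel]
  · rw [(key 0).1.deriv, hD0, Real.cos_zero, mul_one, hC0]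
end

section
/- Under Assumption (E1), there exists a constant K > 0, independent of t and ξ, such that for all t ≥ 0 and all ξ ∈ ℝⁿ, |∫₀ᵗ (Q'(s,ξ)/Q(s,ξ)) cos(2B(s,ξ)) ds| ≤ K, and likewise |∫₀ᵗ (Q'(s,ξ)/Q(s,ξ)) cos(2D(s,ξ)) ds| ≤ K. -/
/-- Integration by parts against a phase `θ` satisfying
`θ' = ω - σ * (g * ω) * sin θ * cos θ` with `|σ| ≤ 1`. -/
lemma abs_integral_mul_cos_le {ω g g' θ H : ℝ → ℝ} {σ G t : ℝ} (ht : 0 ≤ t) (hσ : |σ| ≤ 1)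
    (hω : Continuous ω) (hg' : Continuous g') (hH : Continuous H)
    (hg : ∀ s, HasDerivAt g (g' s) s)
    (hθ : ∀ s, HasDerivAt θ
      (ω s - σ * (g s * ω s) * Real.sin (θ s) * Real.cos (θ s)) s)
    (hG : ∀ s, |g s| ≤ G) (hbound : ∀ s, |g' s| + g s ^ 2 * |ω s| ≤ H s) :
    |∫ s in (0:ℝ)..t, g s * ω s * Real.cos (2 * θ s)| ≤ G + ∫ s in (0:ℝ)..t, H s := by
  have cg : Continuous g := continuous_iff_continuousAt.2 fun s => (hg s).continuousAt
  have cθ : Continuous θ := continuous_iff_continuousAt.2 fun s => (hθ s).continuousAt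
  set r : ℝ → ℝ := fun s => g' s * (Real.sin (2 * θ s) / 2) -
    g s * (σ * (g s * ω s) * Real.sin (θ s) * Real.cos (θ s)) * Real.cos (2 * θ s) with hr
  have cr : Continuous r := by fun_prop
  have cf : Continuous fun s => g s * ω s * Real.cos (2 * θ s) := by fun_prop
  have hF : ∀ s, HasDerivAt (fun s => g s * (Real.sin (2 * θ s) / 2))
      (g s * ω s * Real.cos (2 * θ s) + r s) s := by
    intro s
    refine ((hg s).mul ((((hθ s).const_mul 2).sin).div_const 2)).congr_deriv ?_
    simp only [hr]
    ring
  have hFTC := intervalIntegral.integral_eq_sub_of_hasDerivAt (a := 0) (b := t)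
    (fun s _ => hF s) ((cf.add cr).intervalIntegrable _ _)
  rw [intervalIntegral.integral_add (cf.intervalIntegrable _ _) (cr.intervalIntegrable _ _)]
    at hFTC
  have hrH : |∫ s in (0:ℝ)..t, r s| ≤ ∫ s in (0:ℝ)..t, H s := by
    rw [← Real.norm_eq_abs]
    refine intervalIntegral.norm_integral_le_of_norm_le ht
      (Filter.Eventually.of_forall fun s _ => ?_) (hH.intervalIntegrable _ _)
    rw [Real.norm_eq_abs]
    refine le_trans ?_ (hbound s)
    refine (abs_sub _ _).trans (add_le_add ?_ ?_)
    · rw [abs_mul, abs_div, abs_two]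
      have := Real.abs_sin_le_one (2 * θ s)
      exact mul_le_of_le_one_right (abs_nonneg _) (by linarith)
    · have h : |g s * (σ * (g s * ω s) * Real.sin (θ s) * Real.cos (θ s)) * Real.cos (2 * θ s)| =
          g s ^ 2 * |ω s| *
            (|σ| * |Real.sin (θ s)| * |Real.cos (θ s)| * |Real.cos (2 * θ s)|) := by
        simp only [abs_mul]
        rw [← sq_abs (g s)]
        ring
      rw [h]
      refine mul_le_of_le_one_right (by positivity) ?_
      have h1 := Real.abs_sin_le_one (θ s)
      have h2 := Real.abs_cos_le_one (θ s)
      have h3 := Real.abs_cos_le_one (2 * θ s)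
      exact mul_le_one₀ (mul_le_one₀ (mul_le_one₀ hσ (abs_nonneg _) h1) (abs_nonneg _) h2)
        (abs_nonneg _) h3
  have hend : ∀ s, |g s * (Real.sin (2 * θ s) / 2)| ≤ G / 2 := by
    intro s
    rw [abs_mul, abs_div, abs_two]
    have h1 := Real.abs_sin_le_one (2 * θ s)
    have h2 := mul_le_mul (hG s) h1 (abs_nonneg _) ((abs_nonneg _).trans (hG s))
    linarith
  have h1 := abs_le.1 (hend t)
  have h0 := abs_le.1 (hend 0)
  have h2 := abs_le.1 hrH
  rw [abs_le]
  constructor <;> linarith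

lemma EuclideanSpace.norm_le_sum_abs {ι : Type*} [Fintype ι] (x : EuclideanSpace ℝ ι) :
    ‖x‖ ≤ ∑ j, |x j| := by
  rw [EuclideanSpace.norm_eq]
  refine Real.sqrt_le_iff.2 ⟨by positivity, ?_⟩
  simpa using Finset.sum_sq_le_sq_sum_of_nonneg (s := Finset.univ) (f := fun j => |x j|)
    (fun j _ => abs_nonneg _)

section RelativisticEnergy

variable {V : Type*} [NormedAddCommGroup V] [InnerProductSpace ℝ V]
  {x v a : ℝ → V} {c M : ℝ}

lemma hasDerivAt_sqrt_energy (hM : 0 < M) {s : ℝ} (hx : HasDerivAt x (v s) s) :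
    HasDerivAt (fun τ => √(c ^ 2 * ‖x τ‖ ^ 2 + M ^ 2))
      (c ^ 2 * inner ℝ (x s) (v s) / √(c ^ 2 * ‖x s‖ ^ 2 + M ^ 2)) s := by
  have h := ((hx.norm_sq.const_mul (c ^ 2)).add_const (M ^ 2)).sqrt (by positivity)
  convert h using 1
  field_simp

/-- The quotient `Q' / Q ^ 2` for `Q = √(c² ‖x‖² + M²)` has a derivative controlled by
`(‖x'‖² + ‖x''‖) / Q²`. -/
lemma hasDerivAt_inner_div_energy_cube (hM : 0 < M) {s : ℝ} (hx : HasDerivAt x (v s) s)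
    (hv : HasDerivAt v (a s) s) :
    HasDerivAt (fun τ => c ^ 2 * inner ℝ (x τ) (v τ) / √(c ^ 2 * ‖x τ‖ ^ 2 + M ^ 2) ^ 3)
      (c ^ 2 * (‖v s‖ ^ 2 + inner ℝ (x s) (a s)) / √(c ^ 2 * ‖x s‖ ^ 2 + M ^ 2) ^ 3 -
        3 * (c ^ 2 * inner ℝ (x s) (v s)) ^ 2 / √(c ^ 2 * ‖x s‖ ^ 2 + M ^ 2) ^ 5) s := by
  have hQ : 0 < √(c ^ 2 * ‖x s‖ ^ 2 + M ^ 2) := Real.sqrt_pos.2 (by positivity)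
  refine (((hx.inner ℝ hv).const_mul (c ^ 2)).div
    ((hasDerivAt_sqrt_energy (c := c) hM hx).fun_pow 3) (pow_ne_zero 3 hQ.ne')).congr_deriv ?_
  simp only [real_inner_self_eq_norm_sq]
  field_simp
  ring

lemma abs_mul_inner_le_energy_mul (hc : 0 < c) (y w : V) :
    |c ^ 2 * inner ℝ y w| ≤ c * √(c ^ 2 * ‖y‖ ^ 2 + M ^ 2) * ‖w‖ := by
  have h1 : c * ‖y‖ ≤ √(c ^ 2 * ‖y‖ ^ 2 + M ^ 2) :=
    Real.le_sqrt_of_sq_le (by nlinarith [sq_nonneg M])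
  rw [abs_mul, abs_of_pos (by positivity : 0 < c ^ 2)]
  calc c ^ 2 * |inner ℝ y w| ≤ c ^ 2 * (‖y‖ * ‖w‖) := by
        gcongr; exact abs_real_inner_le_norm y w
    _ = c * (c * ‖y‖) * ‖w‖ := by ring
    _ ≤ _ := by gcongr

/-- Uniform bound for the oscillatory integral of `Q' / Q` against `cos (2 θ)`, where
`Q = √(c² ‖x‖² + M²)` and `θ' = Q - σ (Q' / Q) sin θ cos θ`. -/
lemma abs_integral_logDeriv_energy_mul_cos_le {Q θ : ℝ → ℝ} {σ A e t : ℝ} (ht : 0 ≤ t)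
    (hσ : |σ| ≤ 1) (hc : 0 < c) (hM : 0 < M)
    (hx : ∀ s, HasDerivAt x (v s) s) (hv : ∀ s, HasDerivAt v (a s) s) (ha : Continuous a)
    (hvA : ∀ s, ‖v s‖ ≤ A)
    (he : ∫ s in (0:ℝ)..t, (‖v s‖ ^ 2 + ‖a s‖) / (c ^ 2 * ‖x s‖ ^ 2 + M ^ 2) ≤ e)
    (hQ : ∀ s, Q s = √(c ^ 2 * ‖x s‖ ^ 2 + M ^ 2)) (hθc : Continuous θ)
    (hθ : ∀ s, θ s = ∫ r in (0:ℝ)..s,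
      (Q r - σ * (deriv Q r / Q r) * Real.sin (θ r) * Real.cos (θ r))) :
    |∫ s in (0:ℝ)..t, deriv Q s / Q s * Real.cos (2 * θ s)| ≤
      c * A / M ^ 2 + (5 * c ^ 2 / M + c) * e := by
  have cx : Continuous x := continuous_iff_continuousAt.2 fun s => (hx s).continuousAt
  have cv : Continuous v := continuous_iff_continuousAt.2 fun s => (hv s).continuousAt
  have hQfun : Q = fun s => √(c ^ 2 * ‖x s‖ ^ 2 + M ^ 2) := funext hQ
  have cQ : Continuous Q := by rw [hQfun]; fun_prop
  have hMQ : ∀ s, M ≤ Q s := fun s => by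
    rw [hQ]; exact Real.le_sqrt_of_sq_le (by nlinarith [sq_nonneg (c * ‖x s‖)])
  have Qpos : ∀ s, 0 < Q s := fun s => hM.trans_le (hMQ s)
  have Qne : ∀ s, Q s ≠ 0 := fun s => (Qpos s).ne'
  have hQsq : ∀ s, Q s ^ 2 = c ^ 2 * ‖x s‖ ^ 2 + M ^ 2 := fun s => by
    rw [hQ]; exact Real.sq_sqrt (by positivity)
  set g : ℝ → ℝ := fun s => c ^ 2 * inner ℝ (x s) (v s) / Q s ^ 3 with hgdef
  set g' : ℝ → ℝ := fun s => c ^ 2 * (‖v s‖ ^ 2 + inner ℝ (x s) (a s)) / Q s ^ 3 -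
    3 * (c ^ 2 * inner ℝ (x s) (v s)) ^ 2 / Q s ^ 5 with hg'def
  have hg : ∀ s, HasDerivAt g (g' s) s := fun s => by
    simp only [hgdef, hg'def, hQ]
    exact hasDerivAt_inner_div_energy_cube hM (hx s) (hv s)
  have cg : Continuous g := continuous_iff_continuousAt.2 fun s => (hg s).continuousAt
  have cg' : Continuous g' :=
    ((by fun_prop : Continuous fun s => c ^ 2 * (‖v s‖ ^ 2 + inner ℝ (x s) (a s))).div
      (cQ.pow 3) fun s => pow_ne_zero _ (Qne s)).sub
    ((by fun_prop : Continuous fun s => 3 * (c ^ 2 * inner ℝ (x s) (v s)) ^ 2).div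
      (cQ.pow 5) fun s => pow_ne_zero _ (Qne s))
  have hlog : ∀ s, deriv Q s / Q s = g s * Q s := fun s => by
    have h : deriv Q s = c ^ 2 * inner ℝ (x s) (v s) / Q s := by
      rw [hQ s, hQfun]
      exact (hasDerivAt_sqrt_energy hM (hx s)).deriv
    have := Qne s
    rw [h]
    simp only [hgdef]
    field_simp
  have hinner : ∀ s w, |c ^ 2 * inner ℝ (x s) w| ≤ c * Q s * ‖w‖ := fun s w => by
    rw [hQ]; exact abs_mul_inner_le_energy_mul hc (x s) w
  have hgle : ∀ s, |g s| ≤ c * ‖v s‖ / Q s ^ 2 := fun s => by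
    have h3 := Qpos s
    simp only [hgdef]
    rw [abs_div, abs_of_pos (by positivity : 0 < Q s ^ 3), div_le_div_iff₀ (by positivity)
      (by positivity)]
    calc _ ≤ c * Q s * ‖v s‖ * Q s ^ 2 := by gcongr; exact hinner s (v s)
      _ = _ := by ring
  set H : ℝ → ℝ := fun s => (5 * c ^ 2 / M + c) *
    ((‖v s‖ ^ 2 + ‖a s‖) / (c ^ 2 * ‖x s‖ ^ 2 + M ^ 2)) with hHdef
  have cH : Continuous H := continuous_const.mul
    ((by fun_prop : Continuous fun s => ‖v s‖ ^ 2 + ‖a s‖).div (by fun_prop)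
      fun s => by positivity)
  have hθ' : ∀ s, HasDerivAt θ
      (Q s - σ * (g s * Q s) * Real.sin (θ s) * Real.cos (θ s)) s := fun s => by
    have hc' : Continuous fun r =>
        Q r - σ * (g r * Q r) * Real.sin (θ r) * Real.cos (θ r) := by fun_prop
    have h := intervalIntegral.integral_hasDerivAt_right (hc'.intervalIntegrable 0 s)
      (hc'.stronglyMeasurableAtFilter _ _) hc'.continuousAt
    refine h.congr_of_eventuallyEq (Filter.Eventually.of_forall fun u => ?_)
    rw [hθ u]
    simp only [hlog]
  have hbound : ∀ s, |g' s| + g s ^ 2 * |Q s| ≤ H s := fun s => by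
    have hq := Qpos s
    have hcube : ∀ y, 0 ≤ y → y / Q s ^ 3 ≤ y / (M * Q s ^ 2) := fun y hy => by
      have : M * Q s ^ 2 ≤ Q s ^ 3 := by
        nlinarith [mul_le_mul_of_nonneg_right (hMQ s) (sq_nonneg (Q s))]
      gcongr
    have hsq : (c ^ 2 * inner ℝ (x s) (v s)) ^ 2 ≤ (c * Q s * ‖v s‖) ^ 2 :=
      sq_le_sq.2 ((hinner s (v s)).trans (le_abs_self _))
    have hV : (c ^ 2 * inner ℝ (x s) (v s)) ^ 2 / Q s ^ 5 ≤ c ^ 2 * ‖v s‖ ^ 2 / Q s ^ 3 := by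
      rw [div_le_div_iff₀ (by positivity) (by positivity)]
      calc _ ≤ (c * Q s * ‖v s‖) ^ 2 * Q s ^ 3 := by gcongr
        _ = _ := by ring
    have hgsq : g s ^ 2 * |Q s| = (c ^ 2 * inner ℝ (x s) (v s)) ^ 2 / Q s ^ 5 := by
      rw [abs_of_pos hq]
      simp only [hgdef]
      field_simp
    have hg'le : |g' s| ≤ c ^ 2 * ‖v s‖ ^ 2 / Q s ^ 3 + c * ‖a s‖ / Q s ^ 2 +
        3 * ((c ^ 2 * inner ℝ (x s) (v s)) ^ 2 / Q s ^ 5) := by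
      have e1 : g' s = c ^ 2 * ‖v s‖ ^ 2 / Q s ^ 3 + c ^ 2 * inner ℝ (x s) (a s) / Q s ^ 3 -
          3 * ((c ^ 2 * inner ℝ (x s) (v s)) ^ 2 / Q s ^ 5) := by
        simp only [hg'def]; ring
      have e2 : |c ^ 2 * inner ℝ (x s) (a s) / Q s ^ 3| ≤ c * ‖a s‖ / Q s ^ 2 := by
        rw [abs_div, abs_of_pos (by positivity : 0 < Q s ^ 3), div_le_div_iff₀ (by positivity)
          (by positivity)]
        calc _ ≤ c * Q s * ‖a s‖ * Q s ^ 2 := by gcongr; exact hinner s (a s)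
          _ = _ := by ring
      have p1 : 0 ≤ c ^ 2 * ‖v s‖ ^ 2 / Q s ^ 3 := by positivity
      have p2 : 0 ≤ (c ^ 2 * inner ℝ (x s) (v s)) ^ 2 / Q s ^ 5 := by positivity
      have := abs_le.1 e2
      rw [e1, abs_le]
      constructor <;> linarith
    have h5 := hcube (c ^ 2 * ‖v s‖ ^ 2) (by positivity)
    have hHs : H s = 5 * (c ^ 2 * ‖v s‖ ^ 2 / (M * Q s ^ 2)) + c * ‖a s‖ / Q s ^ 2 +
        (5 * c ^ 2 / M * (‖a s‖ / Q s ^ 2) + c * (‖v s‖ ^ 2 / Q s ^ 2)) := by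
      simp only [hHdef]
      rw [← hQsq]
      field_simp
      ring
    have p3 : 0 ≤ 5 * c ^ 2 / M * (‖a s‖ / Q s ^ 2) + c * (‖v s‖ ^ 2 / Q s ^ 2) := by positivity
    rw [hHs, hgsq]
    linarith
  have hG : ∀ s, |g s| ≤ c * A / M ^ 2 := fun s => by
    have := hMQ s
    have hA := hvA s
    have hA0 := (norm_nonneg _).trans hA
    exact (hgle s).trans (by gcongr)
  simp only [hlog]
  refine (abs_integral_mul_cos_le ht hσ cQ cg' cH hg hθ' hG hbound).trans ?_
  rw [intervalIntegral.integral_const_mul]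
  gcongr

end RelativisticEnergy


open MeasureTheory in
theorem stmt_6
    (n : ℕ) (hn : 1 ≤ n) (c m q : ℝ) (hc : 0 < c) (hm : 0 < m) (hq : q ≠ 0)
    (E : ℝ → EuclideanSpace ℝ (Fin n)) (E00 E01 : ℝ)
    (hE : ContDiff ℝ 1 E)
    (hE00 : ∀ t : ℝ, ∑ j, |E t j| ≤ E00)
    (hE01 : ∀ t : ℝ, ∑ j, |deriv E t j| ≤ E01)
    (b : ℝ → EuclideanSpace ℝ (Fin n))
    (hb : ∀ t : ℝ, b t = ∫ s in (0:ℝ)..t, q • E s)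
    (L Q : ℝ → EuclideanSpace ℝ (Fin n) → ℝ)
    (hL : ∀ (t : ℝ) (ξ : EuclideanSpace ℝ (Fin n)),
      L t ξ = c ^ 2 * ‖ξ + b t‖ ^ 2 + (m * c ^ 2) ^ 2)
    (hQ : ∀ (t : ℝ) (ξ : EuclideanSpace ℝ (Fin n)), Q t ξ = Real.sqrt (L t ξ))
    (B : ℝ → EuclideanSpace ℝ (Fin n) → ℝ)
    (hBC2 : ∀ ξ : EuclideanSpace ℝ (Fin n), ContDiff ℝ 2 (fun t => B t ξ))
    (hB : ∀ (t : ℝ) (ξ : EuclideanSpace ℝ (Fin n)), B t ξ =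
      ∫ s in (0:ℝ)..t,
        (Q s ξ - deriv (fun τ => Q τ ξ) s / Q s ξ * Real.sin (B s ξ) * Real.cos (B s ξ)))
    (D : ℝ → EuclideanSpace ℝ (Fin n) → ℝ)
    (hDC2 : ∀ ξ : EuclideanSpace ℝ (Fin n), ContDiff ℝ 2 (fun t => D t ξ))
    (hD : ∀ (t : ℝ) (ξ : EuclideanSpace ℝ (Fin n)), D t ξ =
      ∫ s in (0:ℝ)..t,
        (Q s ξ + deriv (fun τ => Q τ ξ) s / Q s ξ * Real.sin (D s ξ) * Real.cos (D s ξ)))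
    (hbig : Filter.Tendsto (fun t => ‖b t‖) Filter.atTop Filter.atTop)
    (e0 e1 : ℝ) (he0 : 0 < e0) (he1 : 0 < e1)
    (hE1a : ∀ (a : EuclideanSpace ℝ (Fin n)) (t : ℝ), 0 ≤ t →
      ∫ s in {s : ℝ | s ∈ Set.Icc (0:ℝ) t ∧ ‖a + b s‖ ≤ 2 * E00 / (m * c ^ 2)}, ‖deriv b s‖ ≤ e0)
    (hE1b : ∀ (a : EuclideanSpace ℝ (Fin n)) (t : ℝ), 0 ≤ t →
      ∫ s in (0:ℝ)..t,
        (‖deriv b s‖ ^ 2 + ‖deriv (deriv b) s‖) / (c ^ 2 * ‖a + b s‖ ^ 2 + (m * c ^ 2) ^ 2) ≤ e1)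
    :
    ∃ K : ℝ, 0 < K ∧ ∀ (t : ℝ), 0 ≤ t → ∀ ξ : EuclideanSpace ℝ (Fin n),
      |∫ s in (0:ℝ)..t, deriv (fun τ => Q τ ξ) s / Q s ξ * Real.cos (2 * B s ξ)| ≤ K ∧
      |∫ s in (0:ℝ)..t, deriv (fun τ => Q τ ξ) s / Q s ξ * Real.cos (2 * D s ξ)| ≤ K := by
  have hbE : ∀ s, HasDerivAt b (q • E s) s := fun s => by
    have hc' : Continuous fun r => q • E r := hE.continuous.const_smul q
    rw [funext hb]
    exact intervalIntegral.integral_hasDerivAt_right (hc'.intervalIntegrable 0 s)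
      (hc'.stronglyMeasurableAtFilter _ _) hc'.continuousAt
  have hdb : deriv b = fun s => q • E s := funext fun s => (hbE s).deriv
  have hEd : ∀ s, HasDerivAt (fun s => q • E s) (q • deriv E s) s := fun s =>
    ((hE.differentiable one_ne_zero) s).hasDerivAt.const_smul q
  have hddb : deriv (deriv b) = fun s => q • deriv E s := by
    rw [hdb]; exact funext fun s => (hEd s).deriv
  have cdE : Continuous fun s => q • deriv E s := (hE.continuous_deriv le_rfl).const_smul q
  have hEA : ∀ s, ‖q • E s‖ ≤ |q| * E00 := fun s => by
    rw [norm_smul, Real.norm_eq_abs]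
    gcongr
    exact (EuclideanSpace.norm_le_sum_abs _).trans (hE00 s)
  have hA0 : 0 ≤ |q| * E00 := (norm_nonneg _).trans (hEA 0)
  have hM : 0 < m * c ^ 2 := by positivity
  refine ⟨c * (|q| * E00) / (m * c ^ 2) ^ 2 + (5 * c ^ 2 / (m * c ^ 2) + c) * e1,
    by positivity, fun t ht ξ => ?_⟩
  have hx : ∀ s, HasDerivAt (fun s => ξ + b s) (q • E s) s := fun s => (hbE s).const_add ξ
  have he := hE1b ξ t ht
  rw [hddb, hdb] at he
  have hQξ : ∀ s, Q s ξ = √(c ^ 2 * ‖ξ + b s‖ ^ 2 + (m * c ^ 2) ^ 2) := fun s => by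
    rw [hQ, hL]
  constructor
  · refine abs_integral_logDeriv_energy_mul_cos_le (σ := 1) (Q := fun τ => Q τ ξ)
      (θ := fun τ => B τ ξ) ht (by simp) hc hM hx hEd cdE hEA he hQξ (hBC2 ξ).continuous ?_
    intro s
    simpa only [one_mul] using hB s ξ
  · refine abs_integral_logDeriv_energy_mul_cos_le (σ := -1) (Q := fun τ => Q τ ξ)
      (θ := fun τ => D τ ξ) ht (by simp) hc hM hx hEd cdE hEA he hQξ (hDC2 ξ).continuous ?_
    intro s
    simpa only [neg_one_mul, neg_mul, one_mul, sub_neg_eq_add] using hD s ξ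
end

section
/- Under Assumption (E1), there exist constants 0 < C₀ < ∞ and 0 < C₁ < ∞, independent of t and ξ, such that for all t ≥ 0 and ξ ∈ ℝⁿ: (Q(0,ξ)/Q(t,ξ))^{1/2} e^{−C₀} ≤ |A(t,ξ)| ≤ (Q(0,ξ)/Q(t,ξ))^{1/2} e^{C₀}, and (Q(t,ξ) Q(0,ξ))^{−1/2} e^{−C₁} ≤ |C(t,ξ)| ≤ (Q(t,ξ) Q(0,ξ))^{−1/2} e^{C₁}. -/
/-- Integration by parts against the phase `B`, whose derivative is `Q` up to an error controlled
by `p = g * Q`: the integral of `p * cos (2 * B)` stays bounded when `g` is bounded and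
`|g'| + |g * p|` is dominated by an integrable weight. -/
theorem abs_integral_mul_cos_two_mul_le {Q p g g' w B : ℝ → ℝ} {σ G K e t : ℝ} (ht : 0 ≤ t)
    (hσ : |σ| ≤ 1) (hK : 0 ≤ K) (hp : ∀ s, p s = g s * Q s) (hgc : Continuous g')
    (hpc : Continuous p) (hwc : Continuous w)
    (hg : ∀ s, HasDerivAt g (g' s) s)
    (hB : ∀ s, HasDerivAt B (Q s - σ * (p s * Real.sin (B s) * Real.cos (B s))) s)
    (hG : ∀ s, |g s| ≤ G) (hw : ∀ s, |g' s| + |g s * p s| ≤ K * w s)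
    (he : ∫ s in (0:ℝ)..t, w s ≤ e) :
    |∫ s in (0:ℝ)..t, p s * Real.cos (2 * B s)| ≤ G + K * e := by
  have hBc : Continuous B := continuous_iff_continuousAt.2 fun s => (hB s).continuousAt
  have hgc0 : Continuous g := continuous_iff_continuousAt.2 fun s => (hg s).continuousAt
  let F : ℝ → ℝ := fun s => g s * Real.sin (2 * B s) / 2
  let r : ℝ → ℝ := fun s =>
    σ * (g s * p s) * Real.sin (2 * B s) * Real.cos (2 * B s) / 2 - g' s * Real.sin (2 * B s) / 2
  have hrc : Continuous r := by fun_prop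
  have hpcc : Continuous fun s => p s * Real.cos (2 * B s) := by fun_prop
  have hF : ∀ s, HasDerivAt F (p s * Real.cos (2 * B s) - r s) s := by
    intro s
    have h := ((hg s).mul (((hB s).const_mul 2).sin)).div_const 2
    refine h.congr_deriv ?_
    simp only [r]
    rw [Real.sin_two_mul, hp s]
    ring
  have hint : ∫ s in (0:ℝ)..t, p s * Real.cos (2 * B s) = F t - F 0 + ∫ s in (0:ℝ)..t, r s := by
    have h := intervalIntegral.integral_eq_sub_of_hasDerivAt (a := 0) (b := t)
      (fun s _ => hF s) ((hpcc.sub hrc).intervalIntegrable 0 t)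
    rw [intervalIntegral.integral_sub (hpcc.intervalIntegrable 0 t) (hrc.intervalIntegrable 0 t)]
      at h
    linarith
  have hFb : ∀ s, |F s| ≤ G / 2 := by
    intro s
    have h : |g s * Real.sin (2 * B s)| ≤ G := by
      rw [abs_mul]
      exact (mul_le_of_le_one_right (abs_nonneg _) (Real.abs_sin_le_one _)).trans (hG s)
    simp only [F]
    rw [abs_div, abs_two]
    linarith
  have hrb : ∀ s, |r s| ≤ K * w s := by
    intro s
    have h1 : |σ * (g s * p s) * Real.sin (2 * B s) * Real.cos (2 * B s)| ≤ |g s * p s| := by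
      rw [abs_mul, abs_mul, abs_mul σ]
      have hsin := Real.abs_sin_le_one (2 * B s)
      have hcos := Real.abs_cos_le_one (2 * B s)
      calc _ ≤ 1 * |g s * p s| * 1 * 1 := by gcongr
        _ = _ := by ring
    have h2 : |g' s * Real.sin (2 * B s)| ≤ |g' s| := by
      rw [abs_mul]
      exact mul_le_of_le_one_right (abs_nonneg _) (Real.abs_sin_le_one _)
    have h3 := abs_sub (σ * (g s * p s) * Real.sin (2 * B s) * Real.cos (2 * B s) / 2)
      (g' s * Real.sin (2 * B s) / 2)
    rw [abs_div, abs_div, abs_two] at h3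
    have := hw s
    have := abs_nonneg (g' s)
    have := abs_nonneg (g s * p s)
    simp only [r]
    linarith
  have hri : |∫ s in (0:ℝ)..t, r s| ≤ K * e :=
    calc |∫ s in (0:ℝ)..t, r s| ≤ ∫ s in (0:ℝ)..t, K * w s := by
          rw [← Real.norm_eq_abs]
          exact intervalIntegral.norm_integral_le_of_norm_le ht
            (Filter.Eventually.of_forall fun s _ => hrb s)
            ((hwc.const_mul K).intervalIntegrable 0 t)
      _ = K * ∫ s in (0:ℝ)..t, w s := intervalIntegral.integral_const_mul _ _
      _ ≤ K * e := mul_le_mul_of_nonneg_left he hK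
  rw [hint]
  have h1 := abs_add_le (F t - F 0) (∫ s in (0:ℝ)..t, r s)
  have h2 := abs_sub (F t) (F 0)
  linarith [hFb t, hFb 0]

/-- Bounds on the logarithmic derivative `p` of `Q = √(c²‖x‖² + M²)` along a curve `x`, together
with the representation `p = g * Q` for a differentiable `g`. -/
theorem exists_logDeriv_bounds {V : Type*} [NormedAddCommGroup V] [InnerProductSpace ℝ V]
    {c M R : ℝ} (hc : 0 < c) (hM : 0 < M) {x y z : ℝ → V} (hx : ∀ s, HasDerivAt x (y s) s)
    (hy : ∀ s, HasDerivAt y (z s) s) (hz : Continuous z) (hR : ∀ s, ‖y s‖ ≤ R) {Q : ℝ → ℝ}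
    (hQ : ∀ s, Q s = Real.sqrt (c ^ 2 * ‖x s‖ ^ 2 + M ^ 2)) :
    ∃ p g g' : ℝ → ℝ, Continuous p ∧ Continuous g' ∧ (∀ s, p s = g s * Q s) ∧
      (∀ s, HasDerivAt Q (p s * Q s) s) ∧ (∀ s, HasDerivAt g (g' s) s) ∧
      (∀ s, |g s| ≤ c * R / M ^ 2) ∧
      ∀ s, |g' s| + |g s * p s| ≤
        (5 * c ^ 2 / M + c) * ((‖y s‖ ^ 2 + ‖z s‖) / (c ^ 2 * ‖x s‖ ^ 2 + M ^ 2)) := by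
  have hL : ∀ s, 0 < c ^ 2 * ‖x s‖ ^ 2 + M ^ 2 := fun s => by positivity
  have hQ0 : ∀ s, 0 < Q s := fun s => by rw [hQ s]; exact Real.sqrt_pos.2 (hL s)
  have hQ2 : ∀ s, Q s ^ 2 = c ^ 2 * ‖x s‖ ^ 2 + M ^ 2 := fun s => by
    rw [hQ s, Real.sq_sqrt (hL s).le]
  have hQM : ∀ s, M ≤ Q s := fun s => by
    refine le_of_pow_le_pow_left₀ two_ne_zero (hQ0 s).le ?_
    rw [hQ2 s]
    nlinarith [sq_nonneg (c * ‖x s‖)]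
  have hQx : ∀ s, c * ‖x s‖ ≤ Q s := fun s => by
    refine le_of_pow_le_pow_left₀ two_ne_zero (hQ0 s).le ?_
    rw [hQ2 s]
    nlinarith [sq_nonneg M]
  have hxc : Continuous x := continuous_iff_continuousAt.2 fun s => (hx s).continuousAt
  have hyc : Continuous y := continuous_iff_continuousAt.2 fun s => (hy s).continuousAt
  let r : ℝ → ℝ := fun s => c ^ 2 * inner ℝ (x s) (y s)
  let r' : ℝ → ℝ := fun s => c ^ 2 * (inner ℝ (x s) (z s) + ‖y s‖ ^ 2)
  have hr : ∀ s, HasDerivAt r (r' s) s := fun s => by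
    refine (((hx s).inner ℝ (hy s)).const_mul (c ^ 2)).congr_deriv ?_
    simp only [r', real_inner_self_eq_norm_sq]
  have hQd : ∀ s, HasDerivAt Q (r s / Q s) s := fun s => by
    have h1 : HasDerivAt (fun s => c ^ 2 * ‖x s‖ ^ 2 + M ^ 2) (2 * r s) s := by
      refine (((hx s).norm_sq.const_mul (c ^ 2)).add_const (M ^ 2)).congr_deriv ?_
      simp only [r]
      ring
    have h2 := h1.sqrt (hL s).ne'
    rw [← hQ s] at h2
    refine (h2.congr_of_eventuallyEq (Filter.Eventually.of_forall hQ)).congr_deriv ?_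
    have := (hQ0 s).ne'
    field_simp
  have hQc : Continuous Q := continuous_iff_continuousAt.2 fun s => (hQd s).continuousAt
  have hrc : Continuous r := continuous_iff_continuousAt.2 fun s => (hr s).continuousAt
  have hr'c : Continuous r' := by fun_prop
  have hrb : ∀ s, |r s| ≤ c * Q s * ‖y s‖ := fun s => by
    simp only [r]
    rw [abs_mul, abs_of_nonneg (sq_nonneg c)]
    calc c ^ 2 * |inner ℝ (x s) (y s)| ≤ c ^ 2 * (‖x s‖ * ‖y s‖) := by
          gcongr; exact abs_real_inner_le_norm _ _
      _ = c * (c * ‖x s‖) * ‖y s‖ := by ring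
      _ ≤ _ := by gcongr; exact hQx s
  have hr'b : ∀ s, |r' s| ≤ c * Q s * ‖z s‖ + c ^ 2 * ‖y s‖ ^ 2 := fun s => by
    simp only [r']
    rw [abs_mul, abs_of_nonneg (sq_nonneg c)]
    calc c ^ 2 * |inner ℝ (x s) (z s) + ‖y s‖ ^ 2|
        ≤ c ^ 2 * (‖x s‖ * ‖z s‖ + ‖y s‖ ^ 2) := by
          gcongr
          refine (abs_add_le _ _).trans ?_
          rw [abs_of_nonneg (sq_nonneg ‖y s‖)]
          gcongr
          exact abs_real_inner_le_norm _ _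
      _ = c * (c * ‖x s‖) * ‖z s‖ + c ^ 2 * ‖y s‖ ^ 2 := by ring
      _ ≤ _ := by gcongr; exact hQx s
  have hr2b : ∀ s, r s ^ 2 ≤ c ^ 2 * Q s ^ 2 * ‖y s‖ ^ 2 := fun s => by
    rw [← sq_abs]
    calc |r s| ^ 2 ≤ (c * Q s * ‖y s‖) ^ 2 := by gcongr; exact hrb s
      _ = _ := by ring
  refine ⟨fun s => r s / Q s ^ 2, fun s => r s / Q s ^ 3,
    fun s => r' s / Q s ^ 3 - 3 * r s ^ 2 / Q s ^ 5, ?_, ?_, ?_, ?_, ?_, ?_, ?_⟩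
  · exact hrc.div (hQc.pow 2) fun s => (pow_pos (hQ0 s) 2).ne'
  · exact (hr'c.div (hQc.pow 3) fun s => (pow_pos (hQ0 s) 3).ne').sub
      ((continuous_const.mul (hrc.pow 2)).div (hQc.pow 5) fun s => (pow_pos (hQ0 s) 5).ne')
  · intro s
    have := (hQ0 s).ne'
    field_simp
  · intro s
    refine (hQd s).congr_deriv ?_
    have := (hQ0 s).ne'
    field_simp
  · intro s
    refine ((hr s).div ((hQd s).pow 3) (pow_pos (hQ0 s) 3).ne').congr_deriv ?_
    have := (hQ0 s).ne'
    simp only [Pi.pow_apply]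
    push_cast
    field_simp
  · intro s
    have hq := hQ0 s
    have hR0 : 0 ≤ R := (norm_nonneg _).trans (hR s)
    rw [abs_div, abs_of_pos (pow_pos hq 3)]
    calc |r s| / Q s ^ 3 ≤ c * Q s * ‖y s‖ / Q s ^ 3 := by gcongr; exact hrb s
      _ = c * ‖y s‖ / Q s ^ 2 := by field_simp
      _ ≤ c * R / M ^ 2 := by
        gcongr
        · exact hR s
        · exact hQM s
  · intro s
    have hq := hQ0 s
    rw [← hQ2 s]
    have h2 : r s ^ 2 / Q s ^ 5 ≤ c ^ 2 * ‖y s‖ ^ 2 / (M * Q s ^ 2) :=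
      calc r s ^ 2 / Q s ^ 5 ≤ c ^ 2 * Q s ^ 2 * ‖y s‖ ^ 2 / Q s ^ 5 := by
            gcongr; exact hr2b s
        _ = c ^ 2 * ‖y s‖ ^ 2 / (Q s * Q s ^ 2) := by field_simp
        _ ≤ _ := by gcongr; exact hQM s
    have h1 : |r' s / Q s ^ 3| ≤ c * ‖z s‖ / Q s ^ 2 + c ^ 2 * ‖y s‖ ^ 2 / (M * Q s ^ 2) := by
      rw [abs_div, abs_of_pos (pow_pos hq 3)]
      calc |r' s| / Q s ^ 3 ≤ (c * Q s * ‖z s‖ + c ^ 2 * ‖y s‖ ^ 2) / Q s ^ 3 := by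
            gcongr; exact hr'b s
        _ = c * ‖z s‖ / Q s ^ 2 + c ^ 2 * ‖y s‖ ^ 2 / (Q s * Q s ^ 2) := by field_simp
        _ ≤ _ := by gcongr; exact hQM s
    have h3 : |r' s / Q s ^ 3 - 3 * r s ^ 2 / Q s ^ 5| ≤
        |r' s / Q s ^ 3| + 3 * (r s ^ 2 / Q s ^ 5) := by
      refine (abs_sub _ _).trans (le_of_eq ?_)
      rw [abs_of_nonneg (show 0 ≤ 3 * r s ^ 2 / Q s ^ 5 by positivity)]
      ring
    have h4 : |r s / Q s ^ 3 * (r s / Q s ^ 2)| = r s ^ 2 / Q s ^ 5 := by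
      have h : r s / Q s ^ 3 * (r s / Q s ^ 2) = r s ^ 2 / Q s ^ 5 := by field_simp
      rw [h, abs_of_nonneg (by positivity)]
    have h5 : (5 * c ^ 2 / M + c) * ((‖y s‖ ^ 2 + ‖z s‖) / Q s ^ 2) =
        5 * (c ^ 2 * ‖y s‖ ^ 2 / (M * Q s ^ 2)) + c * ‖z s‖ / Q s ^ 2 +
          (5 * c ^ 2 * ‖z s‖ / (M * Q s ^ 2) + c * ‖y s‖ ^ 2 / Q s ^ 2) := by
      field_simp
      ring
    have h6 : 0 ≤ 5 * c ^ 2 * ‖z s‖ / (M * Q s ^ 2) + c * ‖y s‖ ^ 2 / Q s ^ 2 := by positivity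
    simp only [h4, h5]
    linarith

theorem integral_logDeriv_eq {Q p : ℝ → ℝ} (hQ0 : ∀ s, 0 < Q s) (hpc : Continuous p)
    (hQ : ∀ s, HasDerivAt Q (p s * Q s) s) (t : ℝ) :
    ∫ s in (0:ℝ)..t, p s = Real.log (Q t) - Real.log (Q 0) := by
  refine intervalIntegral.integral_eq_sub_of_hasDerivAt (f := fun s => Real.log (Q s))
    (fun s _ => ?_) (hpc.intervalIntegrable 0 t)
  refine ((hQ s).log (hQ0 s).ne').congr_deriv ?_
  have := (hQ0 s).ne'
  field_simp

theorem exp_half_log_sub_log {u v : ℝ} (hu : 0 < u) (hv : 0 < v) :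
    Real.exp (-((Real.log v - Real.log u) / 2)) = Real.sqrt (u / v) := by
  rw [← Real.exp_log (Real.sqrt_pos.2 (div_pos hu hv)), Real.log_sqrt (div_pos hu hv).le,
    Real.log_div hu.ne' hv.ne']
  ring_nf

theorem hasDerivAt_of_eq_integral {f F : ℝ → ℝ} (hf : Continuous f)
    (hF : ∀ t, F t = ∫ s in (0:ℝ)..t, f s) (t : ℝ) : HasDerivAt F (f t) t := by
  rw [funext hF]
  exact (hf.integral_hasStrictDerivAt 0 t).hasDerivAt

theorem euclideanNorm_le_sum_abs {n : ℕ} (v : EuclideanSpace ℝ (Fin n)) :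
    ‖v‖ ≤ ∑ j, |v j| := by
  refine le_of_pow_le_pow_left₀ two_ne_zero (Finset.sum_nonneg fun j _ => abs_nonneg _) ?_
  rw [EuclideanSpace.norm_sq_eq]
  exact Finset.sum_sq_le_sq_sum_of_nonneg fun j _ => abs_nonneg _

open MeasureTheory in
theorem stmt_7
    (n : ℕ) (hn : 1 ≤ n) (c m q : ℝ) (hc : 0 < c) (hm : 0 < m) (hq : q ≠ 0)
    (E : ℝ → EuclideanSpace ℝ (Fin n)) (E00 E01 : ℝ)
    (hE : ContDiff ℝ 1 E)
    (hE00 : ∀ t : ℝ, ∑ j, |E t j| ≤ E00)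
    (hE01 : ∀ t : ℝ, ∑ j, |deriv E t j| ≤ E01)
    (b : ℝ → EuclideanSpace ℝ (Fin n))
    (hb : ∀ t : ℝ, b t = ∫ s in (0:ℝ)..t, q • E s)
    (L Q : ℝ → EuclideanSpace ℝ (Fin n) → ℝ)
    (hL : ∀ (t : ℝ) (ξ : EuclideanSpace ℝ (Fin n)),
      L t ξ = c ^ 2 * ‖ξ + b t‖ ^ 2 + (m * c ^ 2) ^ 2)
    (hQ : ∀ (t : ℝ) (ξ : EuclideanSpace ℝ (Fin n)), Q t ξ = Real.sqrt (L t ξ))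
    (B : ℝ → EuclideanSpace ℝ (Fin n) → ℝ)
    (hBC2 : ∀ ξ : EuclideanSpace ℝ (Fin n), ContDiff ℝ 2 (fun t => B t ξ))
    (hB : ∀ (t : ℝ) (ξ : EuclideanSpace ℝ (Fin n)), B t ξ =
      ∫ s in (0:ℝ)..t,
        (Q s ξ - deriv (fun τ => Q τ ξ) s / Q s ξ * Real.sin (B s ξ) * Real.cos (B s ξ)))
    (D : ℝ → EuclideanSpace ℝ (Fin n) → ℝ)
    (hDC2 : ∀ ξ : EuclideanSpace ℝ (Fin n), ContDiff ℝ 2 (fun t => D t ξ))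
    (hD : ∀ (t : ℝ) (ξ : EuclideanSpace ℝ (Fin n)), D t ξ =
      ∫ s in (0:ℝ)..t,
        (Q s ξ + deriv (fun τ => Q τ ξ) s / Q s ξ * Real.sin (D s ξ) * Real.cos (D s ξ)))
    (A : ℝ → EuclideanSpace ℝ (Fin n) → ℝ)
    (hA : ∀ (t : ℝ) (ξ : EuclideanSpace ℝ (Fin n)), A t ξ =
      Real.exp (-∫ s in (0:ℝ)..t, deriv (fun τ => Q τ ξ) s / Q s ξ * Real.sin (B s ξ) ^ 2))
    (Cc : ℝ → EuclideanSpace ℝ (Fin n) → ℝ)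
    (hCc : ∀ (t : ℝ) (ξ : EuclideanSpace ℝ (Fin n)), Cc t ξ =
      (Q 0 ξ)⁻¹ * Real.exp (-∫ s in (0:ℝ)..t, deriv (fun τ => Q τ ξ) s / Q s ξ * Real.cos (D s ξ) ^ 2))
    (hbig : Filter.Tendsto (fun t => ‖b t‖) Filter.atTop Filter.atTop)
    (e0 e1 : ℝ) (he0 : 0 < e0) (he1 : 0 < e1)
    (hE1a : ∀ (a : EuclideanSpace ℝ (Fin n)) (t : ℝ), 0 ≤ t →
      ∫ s in {s : ℝ | s ∈ Set.Icc (0:ℝ) t ∧ ‖a + b s‖ ≤ 2 * E00 / (m * c ^ 2)}, ‖deriv b s‖ ≤ e0)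
    (hE1b : ∀ (a : EuclideanSpace ℝ (Fin n)) (t : ℝ), 0 ≤ t →
      ∫ s in (0:ℝ)..t,
        (‖deriv b s‖ ^ 2 + ‖deriv (deriv b) s‖) / (c ^ 2 * ‖a + b s‖ ^ 2 + (m * c ^ 2) ^ 2) ≤ e1)
    :
    ∃ C0 C1 : ℝ, 0 < C0 ∧ 0 < C1 ∧
      ∀ (t : ℝ), 0 ≤ t → ∀ ξ : EuclideanSpace ℝ (Fin n),
        (Real.sqrt (Q 0 ξ / Q t ξ) * Real.exp (-C0) ≤ |A t ξ| ∧
          |A t ξ| ≤ Real.sqrt (Q 0 ξ / Q t ξ) * Real.exp C0) ∧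
        (Real.exp (-C1) / Real.sqrt (Q t ξ * Q 0 ξ) ≤ |Cc t ξ| ∧
          |Cc t ξ| ≤ Real.exp C1 / Real.sqrt (Q t ξ * Q 0 ξ)) := by
  have hM : 0 < m * c ^ 2 := by positivity
  have hEc : Continuous E := hE.continuous
  have hbd : ∀ t, HasDerivAt b (q • E t) t := fun t => by
    rw [funext hb]
    exact ((hEc.const_smul q).integral_hasStrictDerivAt 0 t).hasDerivAt
  have hEd : ∀ t, HasDerivAt (fun s => q • E s) (q • deriv E t) t := fun t =>
    ((hE.differentiable one_ne_zero) t).hasDerivAt.const_smul q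
  have hdE : Continuous (deriv E) := hE.continuous_deriv le_rfl
  have hb1 : deriv b = fun s => q • E s := funext fun t => (hbd t).deriv
  have hb2 : deriv (deriv b) = fun s => q • deriv E s := by
    rw [hb1]
    exact funext fun t => (hEd t).deriv
  have hE00' : ∀ s, ‖q • E s‖ ≤ |q| * E00 := fun s => by
    rw [norm_smul, Real.norm_eq_abs]
    exact mul_le_mul_of_nonneg_left ((euclideanNorm_le_sum_abs _).trans (hE00 s)) (abs_nonneg q)
  have hR : 0 ≤ |q| * E00 := (norm_nonneg _).trans (hE00' 0)
  have hbc : Continuous b := continuous_iff_continuousAt.2 fun s => (hbd s).continuousAt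
  set G := c * (|q| * E00) / (m * c ^ 2) ^ 2
  set K := 5 * c ^ 2 / (m * c ^ 2) + c
  have hK0 : 0 < K := by positivity
  have hG0 : 0 ≤ G := by positivity
  have hC : 0 < (G + K * e1) / 2 := by positivity
  refine ⟨(G + K * e1) / 2, (G + K * e1) / 2, hC, hC, fun t ht ξ => ?_⟩
  obtain ⟨p, g, g', hpc, hg'c, hpg, hQd, hgd, hgb, hw⟩ :=
    exists_logDeriv_bounds (Q := fun s => Q s ξ) hc hM (fun s => (hbd s).const_add ξ) hEd
      (hdE.const_smul q) hE00' (fun s => by rw [hQ, hL])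
  have hQ0 : ∀ s, 0 < Q s ξ := fun s => by
    rw [hQ, hL]
    exact Real.sqrt_pos.2 (by positivity)
  have hQc : Continuous fun s => Q s ξ :=
    continuous_iff_continuousAt.2 fun s => (hQd s).continuousAt
  have hp : ∀ s, deriv (fun τ => Q τ ξ) s / Q s ξ = p s := fun s => by
    rw [(hQd s).deriv]
    exact mul_div_cancel_right₀ _ (hQ0 s).ne'
  have hwc : Continuous fun s => (‖q • E s‖ ^ 2 + ‖q • deriv E s‖) /
      (c ^ 2 * ‖ξ + b s‖ ^ 2 + (m * c ^ 2) ^ 2) :=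
    Continuous.div (by fun_prop) (by fun_prop) fun s => by positivity
  have he := hE1b ξ t ht
  rw [hb2, hb1] at he
  have hA := hA t ξ
  have hCc := hCc t ξ
  have hB := fun t => hB t ξ
  have hD := fun t => hD t ξ
  simp only [hp] at hA hB hCc hD
  have hBc : Continuous fun s => B s ξ := (hBC2 ξ).continuous
  have hDc : Continuous fun s => D s ξ := (hDC2 ξ).continuous
  have hBb := abs_integral_mul_cos_two_mul_le (σ := 1) (B := fun s => B s ξ) ht (by simp) hK0.le
    hpg hg'c hpc hwc hgd
    (fun s => (hasDerivAt_of_eq_integral (by fun_prop) hB s).congr_deriv (by ring))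
    hgb hw he
  have hDb := abs_integral_mul_cos_two_mul_le (σ := -1) (B := fun s => D s ξ) ht (by simp) hK0.le
    hpg hg'c hpc hwc hgd
    (fun s => (hasDerivAt_of_eq_integral (by fun_prop) hD s).congr_deriv (by ring))
    hgb hw he
  have hlog := integral_logDeriv_eq hQ0 hpc hQd t
  have hAeq : A t ξ = Real.sqrt (Q 0 ξ / Q t ξ) *
      Real.exp ((∫ s in (0:ℝ)..t, p s * Real.cos (2 * B s ξ)) / 2) := by
    have h : ∫ s in (0:ℝ)..t, p s * Real.sin (B s ξ) ^ 2 =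
        ((∫ s in (0:ℝ)..t, p s) - ∫ s in (0:ℝ)..t, p s * Real.cos (2 * B s ξ)) / 2 := by
      rw [← intervalIntegral.integral_sub (hpc.intervalIntegrable 0 t)
        (Continuous.intervalIntegrable (by fun_prop) 0 t), ← intervalIntegral.integral_div]
      congr 1
      funext s
      rw [Real.sin_sq_eq_half_sub]
      ring
    rw [hA, h, hlog, ← exp_half_log_sub_log (hQ0 0) (hQ0 t), ← Real.exp_add]
    congr 1
    ring
  have hCeq : Cc t ξ = Real.exp (-(∫ s in (0:ℝ)..t, p s * Real.cos (2 * D s ξ)) / 2) /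
      Real.sqrt (Q t ξ * Q 0 ξ) := by
    have h : ∫ s in (0:ℝ)..t, p s * Real.cos (D s ξ) ^ 2 =
        ((∫ s in (0:ℝ)..t, p s) + ∫ s in (0:ℝ)..t, p s * Real.cos (2 * D s ξ)) / 2 := by
      rw [← intervalIntegral.integral_add (hpc.intervalIntegrable 0 t)
        (Continuous.intervalIntegrable (by fun_prop) 0 t), ← intervalIntegral.integral_div]
      congr 1
      funext s
      rw [Real.cos_sq]
      ring
    have hs : (Q 0 ξ)⁻¹ * Real.sqrt (Q 0 ξ / Q t ξ) = (Real.sqrt (Q t ξ * Q 0 ξ))⁻¹ := by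
      have h0 := Real.sqrt_pos.2 (hQ0 0)
      have h1 := Real.sqrt_pos.2 (hQ0 t)
      rw [Real.sqrt_div (hQ0 0).le, Real.sqrt_mul (hQ0 t).le]
      nth_rewrite 1 [← Real.sq_sqrt (hQ0 0).le]
      field_simp
    rw [hCc, h, hlog, div_eq_inv_mul (Real.exp _), ← hs,
      ← exp_half_log_sub_log (hQ0 0) (hQ0 t), mul_assoc, ← Real.exp_add]
    congr 2
    ring
  rw [abs_le] at hBb hDb
  rw [hAeq, hCeq, abs_of_nonneg (by positivity), abs_of_nonneg (by positivity)]
  refine ⟨⟨?_, ?_⟩, ?_, ?_⟩ <;> gcongr <;> linarith [hBb.1, hBb.2, hDb.1, hDb.2]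
end

section
/- Under Assumption (E1), there exists δ ∈ (0,1] such that |cos(B(t,ξ) − D(t,ξ))| ≥ δ for all t ≥ 0 and all ξ ∈ ℝⁿ. -/
/-- Along a Prüfer-type phase `θ` with `θ' = Q + σ (Q'/Q) sin θ cos θ`, the oscillating term
`(Q'/Q) cos 2θ` is an exact derivative up to an error controlled by `Q''/Q²` and `Q'²/Q³`. -/
theorem abs_oscillation_sub_deriv_le {x y z s k σ : ℝ} (hx : 0 < x) (hσ : |σ| ≤ 1)
    (hsk : s ^ 2 + k ^ 2 = 1) :
    |y / x * (k ^ 2 - s ^ 2) -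
      ((z / (2 * x ^ 2) - y ^ 2 / x ^ 3) * (2 * s * k) +
        y / x ^ 2 * (k ^ 2 - s ^ 2) * (x + σ * (y / x * s * k)))| ≤
      |z| / (2 * x ^ 2) + 2 * (y ^ 2 / x ^ 3) := by
  have e : y / x * (k ^ 2 - s ^ 2) -
      ((z / (2 * x ^ 2) - y ^ 2 / x ^ 3) * (2 * s * k) +
        y / x ^ 2 * (k ^ 2 - s ^ 2) * (x + σ * (y / x * s * k))) =
      -(z / (2 * x ^ 2)) * (2 * s * k) +
        y ^ 2 / x ^ 3 * ((2 * s * k) - σ * ((k ^ 2 - s ^ 2) * (s * k))) := by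
    field_simp
    ring
  have h1 : |2 * s * k| ≤ 1 := by
    rw [abs_le]; constructor <;> nlinarith [sq_nonneg (s + k), sq_nonneg (s - k)]
  have h2 : |k ^ 2 - s ^ 2| ≤ 1 := by
    rw [abs_le]; constructor <;> nlinarith [sq_nonneg s, sq_nonneg k]
  have h3 : |s * k| ≤ 1 := by
    rw [abs_le]; constructor <;> nlinarith [sq_nonneg (s + k), sq_nonneg (s - k)]
  have h4 : |σ * ((k ^ 2 - s ^ 2) * (s * k))| ≤ 1 := by
    rw [abs_mul, abs_mul]
    exact mul_le_one₀ hσ (by positivity) (mul_le_one₀ h2 (abs_nonneg _) h3)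
  have h5 : |(2 * s * k) - σ * ((k ^ 2 - s ^ 2) * (s * k))| ≤ 2 := by
    have := abs_sub (2 * s * k) (σ * ((k ^ 2 - s ^ 2) * (s * k)))
    linarith
  have hw : 0 ≤ y ^ 2 / x ^ 3 := by positivity
  rw [e]
  refine (abs_add_le _ _).trans (add_le_add ?_ ?_)
  · rw [abs_mul, abs_neg, abs_div, abs_of_pos (by positivity : 0 < 2 * x ^ 2)]
    exact mul_le_of_le_one_right (by positivity) h1
  · rw [abs_mul, abs_of_nonneg hw, mul_comm]
    exact mul_le_mul_of_nonneg_right h5 hw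

/-- Derivative of the boundary term `Q' / (2 Q²) sin 2θ`. -/
theorem hasDerivAt_boundary_term {Q Q₁ θ : ℝ → ℝ} {t q₂ θ₁ : ℝ} (hpos : 0 < Q t)
    (hQ : HasDerivAt Q (Q₁ t) t) (hQ₁ : HasDerivAt Q₁ q₂ t) (hθ : HasDerivAt θ θ₁ t) :
    HasDerivAt (fun s => Q₁ s / (2 * Q s ^ 2) * Real.sin (2 * θ s))
      ((q₂ / (2 * Q t ^ 2) - Q₁ t ^ 2 / Q t ^ 3) * (2 * Real.sin (θ t) * Real.cos (θ t)) +
        Q₁ t / Q t ^ 2 * (Real.cos (θ t) ^ 2 - Real.sin (θ t) ^ 2) * θ₁) t := by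
  have h := (hQ₁.div ((hQ.pow 2).const_mul 2)
    (by simpa using hpos.ne')).mul ((hθ.const_mul 2).sin)
  refine h.congr_deriv ?_
  simp only [Pi.div_apply, Pi.pow_apply]
  rw [Real.sin_two_mul, Real.cos_two_mul']
  field_simp
  push_cast
  ring

/-- Quantitative lower bound for the cosine of the phase difference of two Prüfer angles. -/
theorem exp_le_abs_cos_phase_sub {Q Q₁ Q₂ B D g G : ℝ → ℝ} {M C e : ℝ}
    (hpos : ∀ t, 0 < Q t)
    (hQ : ∀ t, HasDerivAt Q (Q₁ t) t) (hQ₁ : ∀ t, HasDerivAt Q₁ (Q₂ t) t)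
    (hB : ∀ t, HasDerivAt B
      (Q t - Q₁ t / Q t * Real.sin (B t) * Real.cos (B t)) t)
    (hD : ∀ t, HasDerivAt D
      (Q t + Q₁ t / Q t * Real.sin (D t) * Real.cos (D t)) t)
    (hB0 : B 0 = 0) (hD0 : D 0 = 0)
    (hG : ∀ t, HasDerivAt G (g t) t) (hG0 : G 0 = 0)
    (hM : ∀ t, |Q₁ t / (2 * Q t ^ 2)| ≤ M) (hC0 : 0 ≤ C)
    (hC : ∀ t, |Q₂ t| / (2 * Q t ^ 2) + 2 * (Q₁ t ^ 2 / Q t ^ 3) ≤ C * g t)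
    {t : ℝ} (ht : 0 ≤ t) (hGe : G t ≤ e) :
    Real.exp (-(M + C * e)) ≤ |Real.cos (B t - D t)| := by
  set HB : ℝ → ℝ := fun s => Q₁ s / (2 * Q s ^ 2) * Real.sin (2 * B s) with hHB
  set HD : ℝ → ℝ := fun s => Q₁ s / (2 * Q s ^ 2) * Real.sin (2 * D s) with hHD
  set v : ℝ → ℝ := fun s =>
    Real.cos (B s - D s) ^ 2 * Real.exp (HB s - HD s + 2 * C * G s) with hv
  have hmono : Monotone v := by
    have hd : ∀ s, ∃ d, HasDerivAt v d s ∧ 0 ≤ d := fun s => by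
      have dB := hasDerivAt_boundary_term (hpos s) (hQ s) (hQ₁ s) (hB s)
      have dD := hasDerivAt_boundary_term (hpos s) (hQ s) (hQ₁ s) (hD s)
      refine ⟨_, ((((hB s).sub (hD s)).cos).pow 2).mul
        (((dB.sub dD).add ((hG s).const_mul (2 * C))).exp), ?_⟩
      have rB := abs_oscillation_sub_deriv_le (y := Q₁ s) (z := Q₂ s) (σ := -1) (hpos s)
        (by simp) (Real.sin_sq_add_cos_sq (B s))
      have rD := abs_oscillation_sub_deriv_le (y := Q₁ s) (z := Q₂ s) (σ := 1) (hpos s)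
        (by simp) (Real.sin_sq_add_cos_sq (D s))
      have rB' := (abs_le.1 (rB.trans (hC s))).2
      have rD' := (abs_le.1 (rD.trans (hC s))).1
      simp only [Pi.sub_apply, Pi.add_apply, Pi.pow_apply]
      rw [show Q s - Q₁ s / Q s * Real.sin (B s) * Real.cos (B s) =
        Q s + -1 * (Q₁ s / Q s * Real.sin (B s) * Real.cos (B s)) by ring,
        show Q s + Q₁ s / Q s * Real.sin (D s) * Real.cos (D s) =
        Q s + 1 * (Q₁ s / Q s * Real.sin (D s) * Real.cos (D s)) by ring]
      set X := (Q₂ s / (2 * Q s ^ 2) - Q₁ s ^ 2 / Q s ^ 3) *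
        (2 * Real.sin (B s) * Real.cos (B s)) +
        Q₁ s / Q s ^ 2 * (Real.cos (B s) ^ 2 - Real.sin (B s) ^ 2) *
          (Q s + -1 * (Q₁ s / Q s * Real.sin (B s) * Real.cos (B s)))
      set Y := (Q₂ s / (2 * Q s ^ 2) - Q₁ s ^ 2 / Q s ^ 3) *
        (2 * Real.sin (D s) * Real.cos (D s)) +
        Q₁ s / Q s ^ 2 * (Real.cos (D s) ^ 2 - Real.sin (D s) ^ 2) *
          (Q s + 1 * (Q₁ s / Q s * Real.sin (D s) * Real.cos (D s)))
      have key : 2 * (-Real.sin (B s - D s) *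
          (Q s + -1 * (Q₁ s / Q s * Real.sin (B s) * Real.cos (B s)) -
            (Q s + 1 * (Q₁ s / Q s * Real.sin (D s) * Real.cos (D s))))) =
          Real.cos (B s - D s) *
            (Q₁ s / Q s * (Real.cos (D s) ^ 2 - Real.sin (D s) ^ 2) -
              Q₁ s / Q s * (Real.cos (B s) ^ 2 - Real.sin (B s) ^ 2)) := by
        have hs : Real.sin (B s) * Real.cos (B s) + Real.sin (D s) * Real.cos (D s) =
            Real.sin (B s + D s) * Real.cos (B s - D s) := by
          rw [Real.sin_add, Real.cos_sub]
          linear_combination -(Real.sin (B s) * Real.cos (B s)) *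
              (Real.sin_sq_add_cos_sq (D s)) -
            (Real.sin (D s) * Real.cos (D s)) * (Real.sin_sq_add_cos_sq (B s))
        have hc : (Real.cos (D s) ^ 2 - Real.sin (D s) ^ 2) -
            (Real.cos (B s) ^ 2 - Real.sin (B s) ^ 2) =
            2 * (Real.sin (B s + D s) * Real.sin (B s - D s)) := by
          rw [Real.sin_add, Real.sin_sub]
          have h1 := Real.sin_sq_add_cos_sq (D s)
          have h2 := Real.sin_sq_add_cos_sq (B s)
          linear_combination (1 - 2 * Real.sin (B s) ^ 2) * h1 +
            (2 * Real.sin (D s) ^ 2 - 1) * h2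
        linear_combination 2 * Real.sin (B s - D s) * (Q₁ s / Q s) * hs -
          Real.cos (B s - D s) * (Q₁ s / Q s) * hc
      have hfin : 0 ≤ Real.cos (B s - D s) ^ 2 *
          Real.exp (HB s - HD s + 2 * C * G s) *
          ((Q₁ s / Q s * (Real.cos (D s) ^ 2 - Real.sin (D s) ^ 2) - Y) -
            (Q₁ s / Q s * (Real.cos (B s) ^ 2 - Real.sin (B s) ^ 2) - X) +
              2 * (C * g s)) :=
        mul_nonneg (by positivity) (by linarith)
      refine hfin.trans_eq ?_
      simp only [Nat.cast_ofNat, Nat.add_one_sub_one, pow_one, hHB, hHD]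
      linear_combination -(Real.cos (B s - D s)) * Real.exp (HB s - HD s + 2 * C * G s) * key
    choose d hd hd0 using hd
    exact monotone_of_hasDerivAt_nonneg hd hd0
  have hv0 : v 0 = 1 := by simp [hv, hHB, hHD, hB0, hD0, hG0]
  have hvt : 1 ≤ v t := hv0 ▸ hmono ht
  have hHle : ∀ θ : ℝ, |Q₁ t / (2 * Q t ^ 2) * Real.sin θ| ≤ M := fun θ => by
    rw [abs_mul]
    exact (mul_le_of_le_one_right (abs_nonneg _) (Real.abs_sin_le_one _)).trans (hM t)
  have hexp : HB t - HD t + 2 * C * G t ≤ 2 * (M + C * e) := by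
    have h1 := (abs_le.1 (hHle (2 * B t))).2
    have h2 := (abs_le.1 (hHle (2 * D t))).1
    have h3 := mul_le_mul_of_nonneg_left hGe hC0
    simp only [hHB, hHD]
    linarith
  have hcos : Real.exp (-(M + C * e)) ^ 2 ≤ Real.cos (B t - D t) ^ 2 := by
    have h1 : 1 ≤ Real.cos (B t - D t) ^ 2 * Real.exp (2 * (M + C * e)) :=
      hvt.trans (mul_le_mul_of_nonneg_left (Real.exp_le_exp.2 hexp) (sq_nonneg _))
    have h2 : Real.exp (-(M + C * e)) ^ 2 = (Real.exp (2 * (M + C * e)))⁻¹ := by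
      rw [← Real.exp_neg, ← Real.exp_nat_mul]
      congr 1
      push_cast
      ring
    rw [h2]
    exact (inv_le_iff_one_le_mul₀ (Real.exp_pos _)).2 h1
  simpa [abs_of_pos (Real.exp_pos _)] using sq_le_sq.1 hcos


open MeasureTheory in
theorem stmt_12
    (n : ℕ) (hn : 1 ≤ n) (c m q : ℝ) (hc : 0 < c) (hm : 0 < m) (hq : q ≠ 0)
    (E : ℝ → EuclideanSpace ℝ (Fin n)) (E00 E01 : ℝ)
    (hE : ContDiff ℝ 1 E)
    (hE00 : ∀ t : ℝ, ∑ j, |E t j| ≤ E00)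
    (hE01 : ∀ t : ℝ, ∑ j, |deriv E t j| ≤ E01)
    (b : ℝ → EuclideanSpace ℝ (Fin n))
    (hb : ∀ t : ℝ, b t = ∫ s in (0:ℝ)..t, q • E s)
    (L Q : ℝ → EuclideanSpace ℝ (Fin n) → ℝ)
    (hL : ∀ (t : ℝ) (ξ : EuclideanSpace ℝ (Fin n)),
      L t ξ = c ^ 2 * ‖ξ + b t‖ ^ 2 + (m * c ^ 2) ^ 2)
    (hQ : ∀ (t : ℝ) (ξ : EuclideanSpace ℝ (Fin n)), Q t ξ = Real.sqrt (L t ξ))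
    (B : ℝ → EuclideanSpace ℝ (Fin n) → ℝ)
    (hBC2 : ∀ ξ : EuclideanSpace ℝ (Fin n), ContDiff ℝ 2 (fun t => B t ξ))
    (hB : ∀ (t : ℝ) (ξ : EuclideanSpace ℝ (Fin n)), B t ξ =
      ∫ s in (0:ℝ)..t,
        (Q s ξ - deriv (fun τ => Q τ ξ) s / Q s ξ * Real.sin (B s ξ) * Real.cos (B s ξ)))
    (D : ℝ → EuclideanSpace ℝ (Fin n) → ℝ)
    (hDC2 : ∀ ξ : EuclideanSpace ℝ (Fin n), ContDiff ℝ 2 (fun t => D t ξ))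
    (hD : ∀ (t : ℝ) (ξ : EuclideanSpace ℝ (Fin n)), D t ξ =
      ∫ s in (0:ℝ)..t,
        (Q s ξ + deriv (fun τ => Q τ ξ) s / Q s ξ * Real.sin (D s ξ) * Real.cos (D s ξ)))
    (hbig : Filter.Tendsto (fun t => ‖b t‖) Filter.atTop Filter.atTop)
    (e0 e1 : ℝ) (he0 : 0 < e0) (he1 : 0 < e1)
    (hE1a : ∀ (a : EuclideanSpace ℝ (Fin n)) (t : ℝ), 0 ≤ t →
      ∫ s in {s : ℝ | s ∈ Set.Icc (0:ℝ) t ∧ ‖a + b s‖ ≤ 2 * E00 / (m * c ^ 2)}, ‖deriv b s‖ ≤ e0)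
    (hE1b : ∀ (a : EuclideanSpace ℝ (Fin n)) (t : ℝ), 0 ≤ t →
      ∫ s in (0:ℝ)..t,
        (‖deriv b s‖ ^ 2 + ‖deriv (deriv b) s‖) / (c ^ 2 * ‖a + b s‖ ^ 2 + (m * c ^ 2) ^ 2) ≤ e1)
    :
    ∃ δ : ℝ, 0 < δ ∧ δ ≤ 1 ∧ ∀ (t : ℝ), 0 ≤ t → ∀ ξ : EuclideanSpace ℝ (Fin n),
      δ ≤ |Real.cos (B t ξ - D t ξ)| := by
  have hbd : ∀ t, HasDerivAt b (q • E t) t := fun t => by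
    have hcont : Continuous fun s => q • E s := hE.continuous.const_smul q
    rw [funext hb]
    exact (hcont.integral_hasStrictDerivAt 0 t).hasDerivAt
  have hdb : deriv b = fun t => q • E t := funext fun t => (hbd t).deriv
  have hEd : ∀ t, HasDerivAt E (deriv E t) t := fun t =>
    (hE.differentiable (by norm_num) t).hasDerivAt
  have hbdd : ∀ t, HasDerivAt (fun t => q • E t) (q • deriv E t) t := fun t =>
    (hEd t).const_smul q
  have hddb : deriv (deriv b) = fun t => q • deriv E t := by
    rw [hdb]
    exact funext fun t => (hbdd t).deriv
  have hEc : Continuous E := hE.continuous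
  have hdEc : Continuous (deriv E) := hE.continuous_deriv (by norm_num)
  have hbc : Continuous b := continuous_iff_continuousAt.2 fun t => (hbd t).continuousAt
  have hEnorm : ∀ t, ‖E t‖ ≤ E00 := fun t => by
    refine le_trans ?_ (hE00 t)
    rw [EuclideanSpace.norm_eq, Real.sqrt_le_left (Finset.sum_nonneg fun _ _ => abs_nonneg _)]
    simpa using Finset.sum_sq_le_sq_sum_of_nonneg
      (s := Finset.univ) (f := fun j => |E t j|) (fun _ _ => abs_nonneg _)
  have hE00' : 0 ≤ E00 := (norm_nonneg _).trans (hEnorm 0)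
  set μ := m * c ^ 2
  have hμ0 : 0 < μ := by positivity
  have hC0 : 0 ≤ 3 * c ^ 2 / μ + c := by positivity
  refine ⟨Real.exp (-(c * (|q| * E00) / (2 * μ ^ 2) + (3 * c ^ 2 / μ + c) * e1)),
    Real.exp_pos _, Real.exp_le_one_iff.2 (neg_nonpos.2 (by positivity)), fun t ht ξ => ?_⟩
  have hLpos : ∀ s, 0 < L s ξ := fun s => by rw [hL]; positivity
  have hQpos : ∀ s, 0 < Q s ξ := fun s => by rw [hQ]; exact Real.sqrt_pos.2 (hLpos s)
  have hQsq : ∀ s, Q s ξ ^ 2 = L s ξ := fun s => by rw [hQ, Real.sq_sqrt (hLpos s).le]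
  have hQμ : ∀ s, μ ≤ Q s ξ := fun s => by
    refine le_of_sq_le_sq ?_ (hQpos s).le
    rw [hQsq, hL]
    nlinarith [mul_nonneg (sq_nonneg c) (sq_nonneg ‖ξ + b s‖)]
  have hQr : ∀ s, c * ‖ξ + b s‖ ≤ Q s ξ := fun s => by
    refine le_of_sq_le_sq ?_ (hQpos s).le
    rw [hQsq, hL]
    nlinarith [sq_nonneg μ]
  have hxd : ∀ s, HasDerivAt (fun s => ξ + b s) (q • E s) s := fun s => (hbd s).const_add ξ
  set P : ℝ → ℝ := fun s => c ^ 2 * inner ℝ (ξ + b s) (q • E s) with hP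
  set R : ℝ → ℝ := fun s => c ^ 2 * (inner ℝ (ξ + b s) (q • deriv E s) +
    inner ℝ (q • E s) (q • E s)) with hR
  have hPd : ∀ s, HasDerivAt P (R s) s := fun s =>
    ((hxd s).inner ℝ (hbdd s)).const_mul (c ^ 2)
  have hQd : ∀ s, HasDerivAt (fun s => Q s ξ) (P s / Q s ξ) s := fun s => by
    have h1 : HasDerivAt (fun s => L s ξ) (c ^ 2 * (2 * inner ℝ (ξ + b s) (q • E s))) s := by
      simp only [hL]
      exact ((hxd s).norm_sq.const_mul (c ^ 2)).add_const _
    have h2 := h1.sqrt (hLpos s).ne'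
    simp only [← hQ] at h2
    refine h2.congr_deriv ?_
    have := (hQpos s).ne'
    simp only [hP]
    field_simp
  have hQ₁d : ∀ s, HasDerivAt (fun s => P s / Q s ξ)
      ((R s * Q s ξ - P s * (P s / Q s ξ)) / Q s ξ ^ 2) s := fun s =>
    (hPd s).div (hQd s) (hQpos s).ne'
  have hderQ : deriv (fun τ => Q τ ξ) = fun s => P s / Q s ξ := funext fun s => (hQd s).deriv
  have hQc : Continuous fun s => Q s ξ :=
    continuous_iff_continuousAt.2 fun s => (hQd s).continuousAt
  have hQ₁c : Continuous fun s => P s / Q s ξ :=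
    continuous_iff_continuousAt.2 fun s => (hQ₁d s).continuousAt
  have hratio : Continuous fun s => P s / Q s ξ / Q s ξ := hQ₁c.div hQc fun s => (hQpos s).ne'
  have hBd : ∀ s, HasDerivAt (fun s => B s ξ) (Q s ξ - P s / Q s ξ / Q s ξ *
      Real.sin (B s ξ) * Real.cos (B s ξ)) s := fun s => by
    have hcont : Continuous fun s => Q s ξ - P s / Q s ξ / Q s ξ *
        Real.sin (B s ξ) * Real.cos (B s ξ) :=
      hQc.sub ((hratio.mul (Real.continuous_sin.comp (hBC2 ξ).continuous)).mul
        (Real.continuous_cos.comp (hBC2 ξ).continuous))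
    have h := (hcont.integral_hasStrictDerivAt 0 s).hasDerivAt
    refine h.congr_of_eventuallyEq (Filter.Eventually.of_forall fun u => ?_)
    simpa only [hderQ] using hB u ξ
  have hDd : ∀ s, HasDerivAt (fun s => D s ξ) (Q s ξ + P s / Q s ξ / Q s ξ *
      Real.sin (D s ξ) * Real.cos (D s ξ)) s := fun s => by
    have hcont : Continuous fun s => Q s ξ + P s / Q s ξ / Q s ξ *
        Real.sin (D s ξ) * Real.cos (D s ξ) :=
      hQc.add ((hratio.mul (Real.continuous_sin.comp (hDC2 ξ).continuous)).mul
        (Real.continuous_cos.comp (hDC2 ξ).continuous))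
    have h := (hcont.integral_hasStrictDerivAt 0 s).hasDerivAt
    refine h.congr_of_eventuallyEq (Filter.Eventually.of_forall fun u => ?_)
    simpa only [hderQ] using hD u ξ
  set g : ℝ → ℝ := fun s => (‖q • E s‖ ^ 2 + ‖q • deriv E s‖) /
    (c ^ 2 * ‖ξ + b s‖ ^ 2 + μ ^ 2) with hg
  have hgQ : ∀ s, g s = (‖q • E s‖ ^ 2 + ‖q • deriv E s‖) / Q s ξ ^ 2 := fun s => by
    rw [hQsq, hL]
  have hgc : Continuous g := by
    refine Continuous.div (by fun_prop) (by fun_prop) fun s => ?_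
    positivity
  have hGd : ∀ s, HasDerivAt (fun s => ∫ u in (0:ℝ)..s, g u) (g s) s := fun s =>
    (hgc.integral_hasStrictDerivAt 0 s).hasDerivAt
  have hPle : ∀ s, |P s| ≤ c * Q s ξ * ‖q • E s‖ := fun s => by
    have h1 := abs_real_inner_le_norm (ξ + b s) (q • E s)
    have h2 := mul_le_mul_of_nonneg_right (hQr s) (norm_nonneg (q • E s))
    simp only [hP]
    rw [abs_mul, abs_of_pos (by positivity : 0 < c ^ 2)]
    nlinarith [mul_le_mul_of_nonneg_left h1 (sq_nonneg c), mul_le_mul_of_nonneg_left h2 hc.le]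
  have hQ₁le : ∀ s, |P s / Q s ξ| ≤ c * ‖q • E s‖ := fun s => by
    rw [abs_div, abs_of_pos (hQpos s), div_le_iff₀ (hQpos s)]
    linarith [hPle s]
  have hRle : ∀ s, |R s| ≤ c * Q s ξ * ‖q • deriv E s‖ + c ^ 2 * ‖q • E s‖ ^ 2 := fun s => by
    have h1 := abs_real_inner_le_norm (ξ + b s) (q • deriv E s)
    have h2 := mul_le_mul_of_nonneg_right (hQr s) (norm_nonneg (q • deriv E s))
    have h3 := abs_add_le (inner ℝ (ξ + b s) (q • deriv E s)) (‖q • E s‖ ^ 2)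
    rw [abs_of_nonneg (sq_nonneg ‖q • E s‖)] at h3
    simp only [hR, real_inner_self_eq_norm_sq]
    rw [abs_mul, abs_of_pos (by positivity : 0 < c ^ 2)]
    nlinarith [mul_le_mul_of_nonneg_left (h3.trans (add_le_add_left h1 _)) (sq_nonneg c),
      mul_le_mul_of_nonneg_left h2 hc.le]
  refine exp_le_abs_cos_phase_sub (Q := fun s => Q s ξ) (B := fun s => B s ξ)
    (D := fun s => D s ξ) hQpos hQd hQ₁d hBd hDd
    ((hB 0 ξ).trans intervalIntegral.integral_same)
    ((hD 0 ξ).trans intervalIntegral.integral_same) hGd (by simp)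
    (fun s => ?_) hC0 (fun s => ?_) ht ?_
  · have hE' : ‖q • E s‖ ≤ |q| * E00 := by
      rw [norm_smul, Real.norm_eq_abs]
      exact mul_le_mul_of_nonneg_left (hEnorm s) (abs_nonneg q)
    rw [abs_div, abs_of_pos (by have := hQpos s; positivity : 0 < 2 * Q s ξ ^ 2)]
    have := hQμ s
    exact div_le_div₀ (by positivity) ((hQ₁le s).trans (mul_le_mul_of_nonneg_left hE' hc.le))
      (by positivity) (by gcongr)
  · have hx := hQpos s
    set x := Q s ξ
    set w := ‖q • E s‖
    set z := ‖q • deriv E s‖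
    have hz0 : 0 ≤ z := norm_nonneg _
    have hsq : (P s / x) ^ 2 ≤ c ^ 2 * w ^ 2 := by
      rw [← sq_abs, ← mul_pow]
      exact pow_le_pow_left₀ (abs_nonneg _) (hQ₁le s) 2
    have hQ₂ : |(R s * x - P s * (P s / x)) / x ^ 2| ≤ c * z + 2 * c ^ 2 * w ^ 2 / x := by
      have e : (R s * x - P s * (P s / x)) / x ^ 2 = (R s - (P s / x) ^ 2) / x := by
        field_simp
      rw [e, abs_div, abs_of_pos hx, div_le_iff₀ hx]
      have h1 := abs_sub (R s) ((P s / x) ^ 2)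
      rw [abs_of_nonneg (sq_nonneg (P s / x))] at h1
      have h2 := hRle s
      have h3 : (c * z + 2 * c ^ 2 * w ^ 2 / x) * x = c * x * z + 2 * (c ^ 2 * w ^ 2) := by
        field_simp
      rw [h3]
      linarith
    calc _ ≤ (c * z + 2 * c ^ 2 * w ^ 2 / x) / (2 * x ^ 2) + 2 * (c ^ 2 * w ^ 2 / x ^ 3) := by
          gcongr
      _ = (c * z / 2 + 3 * c ^ 2 / x * w ^ 2) / x ^ 2 := by
          field_simp
          ring
      _ ≤ ((3 * c ^ 2 / μ + c) * (w ^ 2 + z)) / x ^ 2 := by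
          have h1 : 3 * c ^ 2 / x ≤ 3 * c ^ 2 / μ := by
            gcongr
            exact hQμ s
          have h2 : 0 ≤ 3 * c ^ 2 / μ := by positivity
          gcongr
          nlinarith [mul_le_mul_of_nonneg_right h1 (sq_nonneg w), mul_nonneg h2 hz0,
            mul_nonneg hc.le (sq_nonneg w), mul_nonneg hc.le hz0]
      _ = (3 * c ^ 2 / μ + c) * g s := by rw [hgQ, mul_div_assoc]
  · have h := hE1b ξ t ht
    rw [hddb, hdb] at h
    exact h
end

section
/- (Power-law fields satisfy the second (E1) integral bound, Appendix B.) Let 0 < γ < 1, C_γ ≠ 0, c > 0, m > 0, and set b(s) = C_γ s^γ for s ≥ 1. Then there exists a constant K > 0, depending only on γ, C_γ, c, m, such that for every a ∈ ℝ and every t ≥ 1: ∫₁ᵗ (b'(s)² + |b''(s)|)/(c²(a + b(s))² + (mc²)²) ds ≤ K. -/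
lemma hasDerivAt_arctan_comp_powerLaw {γ C c m a s : ℝ} (hc : 0 < c) (hm : 0 < m) (hs : 0 < s) :
    HasDerivAt (fun s : ℝ => (m * c ^ 3)⁻¹ * Real.arctan ((a + C * s ^ γ) / (m * c)))
      (C * γ * s ^ (γ - 1) / (c ^ 2 * (a + C * s ^ γ) ^ 2 + (m * c ^ 2) ^ 2)) s := by
  have h := (((((Real.hasDerivAt_rpow_const (p := γ) (Or.inl hs.ne')).const_mul C).const_add
    a).div_const (m * c)).arctan).const_mul (m * c ^ 3)⁻¹
  refine h.congr_deriv ?_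
  have h₁ : c ^ 2 * (a + C * s ^ γ) ^ 2 + (m * c ^ 2) ^ 2 ≠ 0 := by positivity
  have h₂ : 1 + ((a + C * s ^ γ) / (m * c)) ^ 2 ≠ 0 := by positivity
  have h₃ : c ^ 2 * (a + C * s ^ γ) ^ 2 + (m * c ^ 2) ^ 2 =
      m ^ 2 * c ^ 4 * (1 + ((a + C * s ^ γ) / (m * c)) ^ 2) := by
    field_simp
    ring
  rw [h₃]
  field_simp

lemma powerLaw_integrand_le {γ C D M s : ℝ} (hγ0 : 0 < γ) (hγ1 : γ < 1) (hM : 0 < M)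
    (hMD : M ≤ D) (hs : 1 ≤ s) :
    ((C * γ * s ^ (γ - 1)) ^ 2 + |C * γ * (γ - 1) * s ^ (γ - 2)|) / D ≤
      C * γ * (C * γ * s ^ (γ - 1) / D) - |C| * γ / M * ((γ - 1) * s ^ (γ - 1 - 1)) := by
  have hs0 : 0 < s := by linarith
  have hD : 0 < D := hM.trans_le hMD
  have habs : |C * γ * (γ - 1) * s ^ (γ - 2)| = |C| * γ * (1 - γ) * s ^ (γ - 2) := by
    rw [abs_mul, abs_mul, abs_mul, abs_of_pos hγ0, abs_of_neg (sub_neg.2 hγ1),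
      abs_of_pos (Real.rpow_pos_of_pos hs0 _), neg_sub]
  have hpow : s ^ (γ - 1) ≤ 1 := Real.rpow_le_one_of_one_le_of_nonpos hs (by linarith)
  have hpos : 0 < s ^ (γ - 1) := Real.rpow_pos_of_pos hs0 _
  have hsq : (C * γ * s ^ (γ - 1)) ^ 2 ≤ C * γ * (C * γ * s ^ (γ - 1)) := by
    nlinarith [mul_le_mul_of_nonneg_left hpow (mul_nonneg (sq_nonneg (C * γ)) hpos.le)]
  have hsecond : |C| * γ * (1 - γ) * s ^ (γ - 2) / D ≤ |C| * γ * (1 - γ) * s ^ (γ - 2) / M := by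
    have : 0 ≤ 1 - γ := by linarith
    gcongr
  rw [habs, add_div, show γ - 1 - 1 = γ - 2 by ring]
  calc _ ≤ C * γ * (C * γ * s ^ (γ - 1)) / D + |C| * γ * (1 - γ) * s ^ (γ - 2) / M := by
        gcongr
    _ = _ := by ring

open MeasureTheory in
theorem stmt_19
    (γ Cγ c m : ℝ) (hγ0 : 0 < γ) (hγ1 : γ < 1) (hCγ : Cγ ≠ 0) (hc : 0 < c) (hm : 0 < m)
    :
    ∃ K : ℝ, 0 < K ∧ ∀ (a : ℝ) (t : ℝ), 1 ≤ t →
      ∫ s in (1:ℝ)..t,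
        ((Cγ * γ * s ^ (γ - 1)) ^ 2 + |Cγ * γ * (γ - 1) * s ^ (γ - 2)|) /
          (c ^ 2 * (a + Cγ * s ^ γ) ^ 2 + (m * c ^ 2) ^ 2) ≤ K := by
  refine ⟨|Cγ| * γ * (m * c ^ 3)⁻¹ * Real.pi + |Cγ| * γ / (m * c ^ 2) ^ 2, by positivity, ?_⟩
  intro a t ht
  have hderiv : ∀ s : ℝ, 1 ≤ s → HasDerivAt
      (fun s : ℝ => Cγ * γ * ((m * c ^ 3)⁻¹ * Real.arctan ((a + Cγ * s ^ γ) / (m * c))) -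
        |Cγ| * γ / (m * c ^ 2) ^ 2 * s ^ (γ - 1))
      (Cγ * γ * (Cγ * γ * s ^ (γ - 1) / (c ^ 2 * (a + Cγ * s ^ γ) ^ 2 + (m * c ^ 2) ^ 2)) -
        |Cγ| * γ / (m * c ^ 2) ^ 2 * ((γ - 1) * s ^ (γ - 1 - 1))) s := by
    intro s hs
    have hs0 : 0 < s := by linarith
    exact ((hasDerivAt_arctan_comp_powerLaw hc hm hs0).const_mul _).sub
      ((Real.hasDerivAt_rpow_const (Or.inl hs0.ne')).const_mul _)
  have hpow : ∀ p : ℝ, ContinuousOn (fun s : ℝ => s ^ p) (Set.Icc 1 t) := fun p =>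
    continuousOn_id.rpow_const fun s hs => Or.inl (by simp only [id]; linarith [hs.1])
  have hint : IntegrableOn (fun s : ℝ =>
      ((Cγ * γ * s ^ (γ - 1)) ^ 2 + |Cγ * γ * (γ - 1) * s ^ (γ - 2)|) /
        (c ^ 2 * (a + Cγ * s ^ γ) ^ 2 + (m * c ^ 2) ^ 2)) (Set.Icc 1 t) := by
    refine ContinuousOn.integrableOn_Icc (ContinuousOn.div ?_ ?_ fun s _ => by positivity)
    · exact ((continuousOn_const.mul (hpow _)).pow 2).add (continuousOn_const.mul (hpow _)).abs
    · exact (continuousOn_const.mul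
        ((continuousOn_const.add (continuousOn_const.mul (hpow _))).pow 2)).add continuousOn_const
  refine (intervalIntegral.integral_le_sub_of_hasDeriv_right_of_le ht
    (fun s hs => (hderiv s hs.1).continuousAt.continuousWithinAt)
    (fun s hs => (hderiv s hs.1.le).hasDerivWithinAt) hint
    (fun s hs => powerLaw_integrand_le hγ0 hγ1 (by positivity)
      (le_add_of_nonneg_left (by positivity)) hs.1.le)).trans ?_
  have harctan : ∀ x y : ℝ, Cγ * (Real.arctan x - Real.arctan y) ≤ |Cγ| * Real.pi := by
    intro x y
    refine (le_abs_self _).trans ?_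
    rw [abs_mul]
    gcongr
    rw [abs_le]
    constructor <;> linarith [Real.arctan_lt_pi_div_two x, Real.arctan_lt_pi_div_two y,
      Real.neg_pi_div_two_lt_arctan x, Real.neg_pi_div_two_lt_arctan y]
  have hmain := mul_le_mul_of_nonneg_left
    (harctan ((a + Cγ * t ^ γ) / (m * c)) ((a + Cγ * 1 ^ γ) / (m * c)))
    (by positivity : 0 ≤ γ * (m * c ^ 3)⁻¹)
  have hrest : 0 ≤ |Cγ| * γ / (m * c ^ 2) ^ 2 * t ^ (γ - 1) := by positivity
  simp only [Real.one_rpow] at hmain ⊢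
  linarith
end
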